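/- arXiv:2605.16021 — 3 statements merged into one kernel-verified Lean document; each statement's English description precedes it below -/
import Mathlib

section
/- Let (x̄,ū) be a feasible process for Problem (P). If, for some δ > 0, Hypotheses (H1)–(H6) are satisfied, then (x̄,ū) satisfies the conditions of the classical weak maximum principle if and only if ℳ(x̄,ū) ∩ (−ℳ_δ(x̄,ū,0)) ≠ ∅. -/
open MeasureTheory Filter Topology Set Pointwise

noncomputable section

/-- Vectors in ℝ^d. -/
abbrev Vec (d : ℕ) : Type := Fin d → ℝ

/-- Dot product. -/
def dotv {d : ℕ} (a b : Vec d) : ℝ := ∑ i, a i * b i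

/-- "P(t) holds a.e. in [t₀,t₁]". -/
def AeOn (t₀ t₁ : ℝ) (P : ℝ → Prop) : Prop :=
  ∀ᵐ t ∂(volume.restrict (Set.Icc t₀ t₁)), P t

/-- Membership in L¹([t₀,t₁]; E). -/
def L1On (t₀ t₁ : ℝ) {E : Type*} [NormedAddCommGroup E] (h : ℝ → E) : Prop :=
  IntegrableOn h (Set.Icc t₀ t₁) volume

/-- Sup (L∞) norm over [t₀,t₁]. -/
def supNorm (t₀ t₁ : ℝ) {E : Type*} [NormedAddCommGroup E] (p : ℝ → E) : ℝ :=
  ⨆ t : Set.Icc t₀ t₁, ‖p t.1‖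

/-- An absolutely continuous arc (element of W^{1,1}([t₀,t₁];ℝ^d)), recorded
together with its (integrable) derivative. -/
structure W11 (t₀ t₁ : ℝ) (d : ℕ) where
  x : ℝ → Vec d
  x' : ℝ → Vec d
  int' : L1On t₀ t₁ x'
  rep : ∀ t ∈ Set.Icc t₀ t₁, x t = x t₀ + ∫ s in t₀..t, x' s

/-- The limiting (Mordukhovich) normal cone of S at z, w.r.t. a pairing. -/
def limNormal {α : Type*} [NormedAddCommGroup α] (pair : α → α → ℝ)
    (S : Set α) (z : α) : Set α :=
  {v | ∃ (vk zk : ℕ → α) (M : ℕ → ℝ),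
      Tendsto vk atTop (𝓝 v) ∧ Tendsto zk atTop (𝓝 z) ∧
      (∀ k, zk k ∈ S) ∧ (∀ k, 0 ≤ M k) ∧
      ∀ k, ∀ y ∈ S, pair (vk k) (y - zk k) ≤ M k * ‖y - zk k‖ ^ 2}

/-- Pairing on a product from pairings on the factors. -/
def pairProd {α β : Type*} (pa : α → α → ℝ) (pb : β → β → ℝ) : α × β → α × β → ℝ :=
  fun a b => pa a.1 b.1 + pb a.2 b.2

/-- The pairing on ℝ. -/
def pairR : ℝ → ℝ → ℝ := fun a b => a * b

/-- Epigraph of a real valued function. -/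
def epigraph {α : Type*} (f : α → ℝ) : Set (α × ℝ) := {p | f p.1 ≤ p.2}

/-- The limiting (Mordukhovich) subdifferential. -/
def limSubdiff {α : Type*} [NormedAddCommGroup α] (pair : α → α → ℝ)
    (f : α → ℝ) (x : α) : Set α :=
  {ξ | ((ξ, (-1 : ℝ)) : α × ℝ) ∈ limNormal (pairProd pair pairR) (epigraph f) (x, f x)}

/-- Convexified limiting subdifferential (co ∂). -/
def clarke {α : Type*} [NormedAddCommGroup α] [NormedSpace ℝ α]
    (pair : α → α → ℝ) (f : α → ℝ) (x : α) : Set α :=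
  convexHull ℝ (limSubdiff pair f x)

/-- Gradient (w.r.t. both variables) of a smooth function of (x,u). -/
def gradFull {n m : ℕ} (h : Vec n × Vec m → ℝ) (z : Vec n × Vec m) : Vec n × Vec m :=
  (fun i => fderiv ℝ h z (Pi.single i 1, 0), fun j => fderiv ℝ h z (0, Pi.single j 1))

/-- Gradient w.r.t. the first (state) variable. -/
def gradX {n m : ℕ} (h : Vec n × Vec m → ℝ) (z : Vec n × Vec m) : Vec n :=
  fun i => fderiv ℝ h z (Pi.single i 1, 0)

/-- Gradient w.r.t. the second (control) variable. -/
def gradU {n m : ℕ} (h : Vec n × Vec m → ℝ) (z : Vec n × Vec m) : Vec m :=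
  fun j => fderiv ℝ h z (0, Pi.single j 1)

/-- The augmented Pontryagin function ℋ(t,x,p,q,r,u), as a function of z = (x,u). -/
def Ham {n m mb mg : ℕ} (f : ℝ → Vec n × Vec m → Vec n) (b : ℝ → Vec n × Vec m → Vec mb)
    (g : ℝ → Vec n × Vec m → Vec mg) (t : ℝ) (p : Vec n) (q : Vec mb) (r : Vec mg)
    (z : Vec n × Vec m) : ℝ :=
  dotv p (f t z) + dotv q (b t z) + dotv r (g t z)

/-- g_j⁻(t,x,u) := max{-g_j(t,x,u), 0}. -/
def gneg {n m mg : ℕ} (g : ℝ → Vec n × Vec m → Vec mg) (t : ℝ) (z : Vec n × Vec m)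
    (j : Fin mg) : ℝ :=
  max (-(g t z j)) 0

/-- U_δ(t) := (ū(t) + δB) ∩ U(t). -/
def Udelta {m : ℕ} (U : ℝ → Set (Vec m)) (ub : ℝ → Vec m) (δ t : ℝ) : Set (Vec m) :=
  Metric.closedBall (ub t) δ ∩ U t

/-- A feasible process for problem (P). -/
def Feasible (t₀ t₁ : ℝ) {n m mb mg : ℕ} (f : ℝ → Vec n × Vec m → Vec n)
    (b : ℝ → Vec n × Vec m → Vec mb) (g : ℝ → Vec n × Vec m → Vec mg)
    (U : ℝ → Set (Vec m)) (C : Set (Vec n × Vec n))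
    (x : W11 t₀ t₁ n) (u : ℝ → Vec m) : Prop :=
  L1On t₀ t₁ u ∧
  AeOn t₀ t₁ (fun t => x.x' t = f t (x.x t, u t)) ∧
  AeOn t₀ t₁ (fun t => b t (x.x t, u t) = 0) ∧
  AeOn t₀ t₁ (fun t => ∀ j, g t (x.x t, u t) j ≤ 0) ∧
  AeOn t₀ t₁ (fun t => u t ∈ U t) ∧
  (x.x t₀, x.x t₁) ∈ C

/-- A weak local minimizer of problem (P). -/
def WeakLocalMin (t₀ t₁ : ℝ) {n m mb mg : ℕ} (ell : Vec n × Vec n → ℝ)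
    (f : ℝ → Vec n × Vec m → Vec n) (b : ℝ → Vec n × Vec m → Vec mb)
    (g : ℝ → Vec n × Vec m → Vec mg) (U : ℝ → Set (Vec m)) (C : Set (Vec n × Vec n))
    (xb : W11 t₀ t₁ n) (ub : ℝ → Vec m) : Prop :=
  Feasible t₀ t₁ f b g U C xb ub ∧
  ∃ δ > (0 : ℝ), ∀ (x : W11 t₀ t₁ n) (u : ℝ → Vec m),
    Feasible t₀ t₁ f b g U C x u →
    AeOn t₀ t₁ (fun t => (x.x t, u t) ∈ Metric.closedBall (xb.x t, ub t) δ) →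
    ell (xb.x t₀, xb.x t₁) ≤ ell (x.x t₀, x.x t₁)

/-- The classical Weak Maximum Principle. -/
def SatisfiesWMP (t₀ t₁ : ℝ) {n m mb mg : ℕ} (ell : Vec n × Vec n → ℝ)
    (f : ℝ → Vec n × Vec m → Vec n) (b : ℝ → Vec n × Vec m → Vec mb)
    (g : ℝ → Vec n × Vec m → Vec mg) (U : ℝ → Set (Vec m)) (C : Set (Vec n × Vec n))
    (xb : W11 t₀ t₁ n) (ub : ℝ → Vec m) : Prop :=
  ∃ (lam : ℝ) (p : W11 t₀ t₁ n) (q : ℝ → Vec mb) (r : ℝ → Vec mg) (ζ : ℝ → Vec m),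
    0 ≤ lam ∧ L1On t₀ t₁ q ∧ L1On t₀ t₁ r ∧ L1On t₀ t₁ ζ ∧
    lam + supNorm t₀ t₁ p.x ≠ 0 ∧
    AeOn t₀ t₁ (fun t => (-(p.x' t), ζ t) ∈
      clarke (pairProd dotv dotv) (Ham f b g t (p.x t) (q t) (r t)) (xb.x t, ub t)) ∧
    AeOn t₀ t₁ (fun t => ζ t ∈ convexHull ℝ (limNormal dotv (U t) (ub t))) ∧
    AeOn t₀ t₁ (fun t => dotv (r t) (g t (xb.x t, ub t)) = 0 ∧ ∀ j, r t j ≤ 0) ∧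
    (p.x t₀, -(p.x t₁)) ∈
      lam • limSubdiff (pairProd dotv dotv) ell (xb.x t₀, xb.x t₁) +
        limNormal (pairProd dotv dotv) C (xb.x t₀, xb.x t₁)

/-- An extremal process in the smooth setting, with prescribed multipliers (λ,p). -/
def SmoothExtremal (t₀ t₁ : ℝ) {n m mb mg : ℕ} (ell : Vec n × Vec n → ℝ)
    (f : ℝ → Vec n × Vec m → Vec n) (b : ℝ → Vec n × Vec m → Vec mb)
    (g : ℝ → Vec n × Vec m → Vec mg) (U : ℝ → Set (Vec m)) (C : Set (Vec n × Vec n))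
    (xb : W11 t₀ t₁ n) (ub : ℝ → Vec m) (lam : ℝ) (p : W11 t₀ t₁ n) : Prop :=
  ∃ (q : ℝ → Vec mb) (r : ℝ → Vec mg) (ζ : ℝ → Vec m),
    L1On t₀ t₁ q ∧ L1On t₀ t₁ r ∧ L1On t₀ t₁ ζ ∧
    lam + supNorm t₀ t₁ p.x ≠ 0 ∧
    AeOn t₀ t₁ (fun t => (-(p.x' t), ζ t) =
      gradFull (Ham f b g t (p.x t) (q t) (r t)) (xb.x t, ub t)) ∧
    AeOn t₀ t₁ (fun t => ζ t ∈ convexHull ℝ (limNormal dotv (U t) (ub t))) ∧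
    AeOn t₀ t₁ (fun t => dotv (r t) (g t (xb.x t, ub t)) = 0 ∧ ∀ j, r t j ≤ 0) ∧
    ∃ w ∈ limNormal (pairProd dotv dotv) C (xb.x t₀, xb.x t₁),
      (p.x t₀, -(p.x t₁)) = lam • gradFull ell (xb.x t₀, xb.x t₁) + w

/-! ### Hypotheses (H1)–(H10) -/

def Hyp1 (t₀ t₁ : ℝ) {n m : ℕ} (f : ℝ → Vec n × Vec m → Vec n)
    (xb : W11 t₀ t₁ n) (ub : ℝ → Vec m) (δ : ℝ) : Prop :=
  (∀ z, Measurable fun t => f t z) ∧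
  ∃ kf : ℝ → ℝ, IntegrableOn kf (Set.Icc t₀ t₁) volume ∧
    AeOn t₀ t₁ (fun t => ∀ z z' : Vec n × Vec m,
      z ∈ Metric.closedBall (xb.x t, ub t) δ → z' ∈ Metric.closedBall (xb.x t, ub t) δ →
      ‖f t z - f t z'‖ ≤ kf t * ‖z - z'‖)

def Hyp2 (t₀ t₁ : ℝ) {m : ℕ} (U : ℝ → Set (Vec m)) (ub : ℝ → Vec m) (δ : ℝ) : Prop :=
  MeasurableSet {p : ℝ × Vec m | p.2 ∈ U p.1} ∧
  AeOn t₀ t₁ (fun t => IsClosed (Udelta U ub δ t) ∧ Convex ℝ (Udelta U ub δ t))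

def Hyp3 (t₀ t₁ : ℝ) {n : ℕ} (ell : Vec n × Vec n → ℝ) (C : Set (Vec n × Vec n))
    (xb : W11 t₀ t₁ n) : Prop :=
  IsClosed C ∧ ∃ (K : NNReal) (ε : ℝ), 0 < ε ∧
    LipschitzOnWith K ell (Metric.ball (xb.x t₀, xb.x t₁) ε)

def Hyp4 (t₀ t₁ : ℝ) {n m mb mg : ℕ} (b : ℝ → Vec n × Vec m → Vec mb)
    (g : ℝ → Vec n × Vec m → Vec mg) : Prop :=
  ∀ z, Measurable (fun t => b t z) ∧ Measurable (fun t => g t z)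

def Hyp5 (t₀ t₁ : ℝ) {n m mb mg : ℕ} (b : ℝ → Vec n × Vec m → Vec mb)
    (g : ℝ → Vec n × Vec m → Vec mg) (xb : W11 t₀ t₁ n) (ub : ℝ → Vec m) (δ : ℝ) : Prop :=
  AeOn t₀ t₁ (fun t => ContDiffOn ℝ 1 (fun z => (b t z, g t z))
      (Metric.closedBall (xb.x t, ub t) δ)) ∧
  ∃ kbg : ℝ → ℝ, IntegrableOn kbg (Set.Icc t₀ t₁) volume ∧
    AeOn t₀ t₁ (fun t => ∀ z z' : Vec n × Vec m,
      z ∈ Metric.closedBall (xb.x t, ub t) δ → z' ∈ Metric.closedBall (xb.x t, ub t) δ →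
      ‖((b t z, g t z) : Vec mb × Vec mg) - (b t z', g t z')‖ ≤ kbg t * ‖z - z'‖)

/-- The part of (H6) concerning (b,g) and ū. -/
def Hyp6bg (t₀ t₁ : ℝ) {n m mb mg : ℕ} (b : ℝ → Vec n × Vec m → Vec mb)
    (g : ℝ → Vec n × Vec m → Vec mg) (xb : W11 t₀ t₁ n) (ub : ℝ → Vec m) : Prop :=
  IntegrableOn (fun t => ‖((b t (xb.x t, ub t), g t (xb.x t, ub t)) : Vec mb × Vec mg)‖)
    (Set.Icc t₀ t₁) volume ∧
  ∃ M : ℝ, AeOn t₀ t₁ (fun t => ‖ub t‖ ≤ M)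

def Hyp6 (t₀ t₁ : ℝ) {n m mb mg : ℕ} (f : ℝ → Vec n × Vec m → Vec n)
    (b : ℝ → Vec n × Vec m → Vec mb) (g : ℝ → Vec n × Vec m → Vec mg)
    (xb : W11 t₀ t₁ n) (ub : ℝ → Vec m) : Prop :=
  IntegrableOn (fun t => ‖f t (xb.x t, ub t)‖) (Set.Icc t₀ t₁) volume ∧
  Hyp6bg t₀ t₁ b g xb ub

/-! ### Weak convergence notions -/

/-- Weak convergence in L¹([t₀,t₁];ℝ^d) (testing against L^∞ functions). -/
def WeakL1Conv (t₀ t₁ : ℝ) {d : ℕ} (hk : ℕ → ℝ → Vec d) (h : ℝ → Vec d) : Prop :=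
  ∀ w : ℝ → Vec d, Measurable w → (∃ M : ℝ, ∀ t, ‖w t‖ ≤ M) →
    Tendsto (fun k => ∫ t in Set.Icc t₀ t₁, dotv (hk k t) (w t)) atTop
      (𝓝 (∫ t in Set.Icc t₀ t₁, dotv (h t) (w t)))

/-- Weak convergence in L²([t₀,t₁];ℝ^d). -/
def WeakL2Conv (t₀ t₁ : ℝ) {d : ℕ} (vk : ℕ → ℝ → Vec d) (v : ℝ → Vec d) : Prop :=
  ∀ w : ℝ → Vec d, Measurable w → IntegrableOn (fun t => ‖w t‖ ^ 2) (Set.Icc t₀ t₁) volume →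
    Tendsto (fun k => ∫ t in Set.Icc t₀ t₁, dotv (vk k t) (w t)) atTop
      (𝓝 (∫ t in Set.Icc t₀ t₁, dotv (v t) (w t)))

/-- Weak convergence in W^{1,1} (initial values converge, derivatives converge weakly in L¹). -/
def WeakW11Conv (t₀ t₁ : ℝ) {n : ℕ} (xk : ℕ → W11 t₀ t₁ n) (x : W11 t₀ t₁ n) : Prop :=
  Tendsto (fun k => (xk k).x t₀) atTop (𝓝 (x.x t₀)) ∧
  WeakL1Conv t₀ t₁ (fun k => (xk k).x') x.x'

/-- Membership in the set D of (H7). -/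
def InD (t₀ t₁ : ℝ) {n m : ℕ} (xb : W11 t₀ t₁ n) (ub : ℝ → Vec m) (δ : ℝ)
    (x : W11 t₀ t₁ n) (v : ℝ → Vec m) : Prop :=
  Measurable v ∧ IntegrableOn (fun t => ‖v t‖ ^ 2) (Set.Icc t₀ t₁) volume ∧
  AeOn t₀ t₁ (fun t => (x.x t, v t) ∈ Metric.closedBall (xb.x t, ub t) δ)

/-- The penalty functional 𝒫 of (H7). -/
def Pval (t₀ t₁ : ℝ) {n m mb mg : ℕ} (b : ℝ → Vec n × Vec m → Vec mb)
    (g : ℝ → Vec n × Vec m → Vec mg) (x : W11 t₀ t₁ n) (v : ℝ → Vec m) : ℝ :=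
  ∫ t in Set.Icc t₀ t₁,
    ((∑ i, (b t (x.x t, v t) i) ^ 2) + ∑ j, (max (g t (x.x t, v t) j) 0) ^ 2)

/-- Hypothesis (H7): ℱ is completely continuous and 𝒫 is weakly sequentially l.s.c. on D. -/
def Hyp7 (t₀ t₁ : ℝ) {n m mb mg : ℕ} (f : ℝ → Vec n × Vec m → Vec n)
    (b : ℝ → Vec n × Vec m → Vec mb) (g : ℝ → Vec n × Vec m → Vec mg)
    (xb : W11 t₀ t₁ n) (ub : ℝ → Vec m) (δ : ℝ) : Prop :=
  (∀ (xk : ℕ → W11 t₀ t₁ n) (vk : ℕ → ℝ → Vec m) (x : W11 t₀ t₁ n) (v : ℝ → Vec m),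
    (∀ k, InD t₀ t₁ xb ub δ (xk k) (vk k)) → InD t₀ t₁ xb ub δ x v →
    WeakW11Conv t₀ t₁ xk x → WeakL2Conv t₀ t₁ vk v →
    TendstoUniformlyOn (fun k t => ∫ s in t₀..t, f s ((xk k).x s, vk k s))
      (fun t => ∫ s in t₀..t, f s (x.x s, v s)) atTop (Set.Icc t₀ t₁)) ∧
  (∀ (xk : ℕ → W11 t₀ t₁ n) (vk : ℕ → ℝ → Vec m) (x : W11 t₀ t₁ n) (v : ℝ → Vec m),
    (∀ k, InD t₀ t₁ xb ub δ (xk k) (vk k)) → InD t₀ t₁ xb ub δ x v →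
    WeakW11Conv t₀ t₁ xk x → WeakL2Conv t₀ t₁ vk v →
    Pval t₀ t₁ b g x v ≤ Filter.liminf (fun k => Pval t₀ t₁ b g (xk k) (vk k)) atTop)

/-! ### AWMP sequences -/

/-- The conditions defining an AWMP sequence (Definition 3.1), with all the data explicit. -/
def AWMPConds (t₀ t₁ : ℝ) {n m mb mg : ℕ} (ell : Vec n × Vec n → ℝ)
    (f : ℝ → Vec n × Vec m → Vec n) (b : ℝ → Vec n × Vec m → Vec mb)
    (g : ℝ → Vec n × Vec m → Vec mg) (U : ℝ → Set (Vec m)) (C : Set (Vec n × Vec n))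
    (ub : ℝ → Vec m) (δ : ℝ)
    (x : ℕ → W11 t₀ t₁ n) (u : ℕ → ℝ → Vec m) (ζ : ℕ → ℝ → Vec m)
    (p : ℕ → W11 t₀ t₁ n) (q : ℕ → ℝ → Vec mb) (r : ℕ → ℝ → Vec mg) (lam : ℕ → ℝ)
    (ε : ℕ → ℝ → Vec n) (η : ℕ → ℝ → Vec m) (θ : ℕ → ℝ → Vec mg)
    (ϑ ν : ℕ → Vec n) : Prop :=
  (∀ k, 0 ≤ lam k) ∧
  (∀ k, L1On t₀ t₁ (u k) ∧ L1On t₀ t₁ (ζ k) ∧ L1On t₀ t₁ (q k) ∧ L1On t₀ t₁ (r k) ∧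
        L1On t₀ t₁ (ε k) ∧ L1On t₀ t₁ (η k) ∧ L1On t₀ t₁ (θ k)) ∧
  (∀ k, AeOn t₀ t₁ (fun t => ∀ j, θ k t j ≤ 0)) ∧
  -- (i)
  (∀ k, lam k + supNorm t₀ t₁ (p k).x = 1) ∧
  -- (ii)
  (∀ k, AeOn t₀ t₁ (fun t =>
      (-(p k).x' t - ε k t, ζ k t - η k t) ∈
        clarke (pairProd dotv dotv) (Ham f b g t ((p k).x t) (q k t) (r k t))
          ((x k).x t, u k t))) ∧
  -- (iii)
  (∀ k, AeOn t₀ t₁ (fun t => ζ k t ∈ limNormal dotv (Udelta U ub δ t) (u k t))) ∧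
  -- (iv)
  (∀ k, AeOn t₀ t₁ (fun t => ∀ j,
      r k t j * gneg g t ((x k).x t, u k t) j = θ k t j ∧ r k t j ≤ 0)) ∧
  -- (v)
  (∀ k, ((p k).x t₀ - ϑ k, -((p k).x t₁) - ν k) ∈
      lam k • limSubdiff (pairProd dotv dotv) ell ((x k).x t₀, (x k).x t₁) +
        limNormal (pairProd dotv dotv) C ((x k).x t₀, (x k).x t₁)) ∧
  -- convergences
  WeakL1Conv t₀ t₁ ε (fun _ => 0) ∧
  WeakL1Conv t₀ t₁ η (fun _ => 0) ∧
  AeOn t₀ t₁ (fun t => ∀ j, Tendsto (fun k => θ k t j) atTop (𝓝 0)) ∧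
  Tendsto ϑ atTop (𝓝 0) ∧ Tendsto ν atTop (𝓝 0)

/-- An asymptotic extremal (Definition 3.2). -/
def AsymptoticExtremal (t₀ t₁ : ℝ) {n m mb mg : ℕ} (ell : Vec n × Vec n → ℝ)
    (f : ℝ → Vec n × Vec m → Vec n) (b : ℝ → Vec n × Vec m → Vec mb)
    (g : ℝ → Vec n × Vec m → Vec mg) (U : ℝ → Set (Vec m)) (C : Set (Vec n × Vec n))
    (xb : W11 t₀ t₁ n) (ub : ℝ → Vec m) : Prop :=
  Feasible t₀ t₁ f b g U C xb ub ∧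
  ∃ (x : ℕ → W11 t₀ t₁ n) (u : ℕ → ℝ → Vec m) (ζ : ℕ → ℝ → Vec m)
    (p : ℕ → W11 t₀ t₁ n) (q : ℕ → ℝ → Vec mb) (r : ℕ → ℝ → Vec mg) (lam : ℕ → ℝ)
    (δ : ℝ) (ε : ℕ → ℝ → Vec n) (η : ℕ → ℝ → Vec m) (θ : ℕ → ℝ → Vec mg)
    (ϑ ν : ℕ → Vec n),
    0 < δ ∧
    AWMPConds t₀ t₁ ell f b g U C ub δ x u ζ p q r lam ε η θ ϑ ν ∧
    TendstoUniformlyOn (fun k => (x k).x) xb.x atTop (Set.Icc t₀ t₁) ∧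
    Tendsto (fun k => ∫ t in Set.Icc t₀ t₁, ‖u k t - ub t‖) atTop (𝓝 0)

/-! ### The sets ℳ and ℳ_δ, the weak outer limit, and AWMP-regularity -/

/-- The set ℳ(x,u). Elements are quadruples (φ,ψ,γ,ξ). -/
def Mset (t₀ t₁ : ℝ) {n m : ℕ} (ell : Vec n × Vec n → ℝ) (f : ℝ → Vec n × Vec m → Vec n)
    (x : W11 t₀ t₁ n) (u : ℝ → Vec m) :
    Set ((ℝ → Vec n) × (ℝ → Vec m) × Vec n × Vec n) :=
  {Φ | L1On t₀ t₁ Φ.1 ∧ L1On t₀ t₁ Φ.2.1 ∧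
    ∃ (lam : ℝ) (p : W11 t₀ t₁ n), 0 ≤ lam ∧ lam + supNorm t₀ t₁ p.x ≠ 0 ∧
      AeOn t₀ t₁ (fun t => (Φ.1 t - p.x' t, Φ.2.1 t) ∈
        clarke (pairProd dotv dotv) (fun z => dotv (p.x t) (f t z)) (x.x t, u t)) ∧
      (Φ.2.2.1 + p.x t₀, Φ.2.2.2 - p.x t₁) ∈
        lam • limSubdiff (pairProd dotv dotv) ell (x.x t₀, x.x t₁)}

/-- The witness conditions for membership in ℳ_δ(x,u,θ), with multipliers (q,r,ζ) explicit. -/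
def MdeltaWitness (t₀ t₁ : ℝ) {n m mb mg : ℕ} (b : ℝ → Vec n × Vec m → Vec mb)
    (g : ℝ → Vec n × Vec m → Vec mg) (U : ℝ → Set (Vec m)) (C : Set (Vec n × Vec n))
    (xb : W11 t₀ t₁ n) (ub : ℝ → Vec m) (δ : ℝ) (kψ : ℝ → ℝ)
    (x : W11 t₀ t₁ n) (u : ℝ → Vec m) (θ : ℝ → Vec mg)
    (Φ : (ℝ → Vec n) × (ℝ → Vec m) × Vec n × Vec n)
    (q : ℝ → Vec mb) (r : ℝ → Vec mg) (ζ : ℝ → Vec m) : Prop :=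
  L1On t₀ t₁ q ∧ L1On t₀ t₁ r ∧ L1On t₀ t₁ ζ ∧
  AeOn t₀ t₁ (fun t => (x.x t, u t) ∈ Metric.closedBall (xb.x t, ub t) δ) ∧
  AeOn t₀ t₁ (fun t =>
    ((Φ.1 t, Φ.2.1 t) : Vec n × Vec m) =
      (∑ i, q t i • gradFull (fun z => b t z i) (x.x t, u t)) +
      (∑ j, r t j • gradFull (fun z => g t z j) (x.x t, u t)) +
      (0, -ζ t)) ∧
  AeOn t₀ t₁ (fun t => ζ t ∈ limNormal dotv (Udelta U ub δ t) (u t)) ∧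
  AeOn t₀ t₁ (fun t => ∀ j, r t j * gneg g t (x.x t, u t) j = θ t j ∧ r t j ≤ 0) ∧
  AeOn t₀ t₁ (fun t => ‖Φ.2.1 t‖ ≤ kψ t) ∧
  (Φ.2.2.1, Φ.2.2.2) ∈ limNormal (pairProd dotv dotv) C (x.x t₀, x.x t₁)

/-- The set ℳ_δ(x,u,θ). -/
def Mdelta (t₀ t₁ : ℝ) {n m mb mg : ℕ} (b : ℝ → Vec n × Vec m → Vec mb)
    (g : ℝ → Vec n × Vec m → Vec mg) (U : ℝ → Set (Vec m)) (C : Set (Vec n × Vec n))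
    (xb : W11 t₀ t₁ n) (ub : ℝ → Vec m) (δ : ℝ) (kψ : ℝ → ℝ)
    (x : W11 t₀ t₁ n) (u : ℝ → Vec m) (θ : ℝ → Vec mg) :
    Set ((ℝ → Vec n) × (ℝ → Vec m) × Vec n × Vec n) :=
  {Φ | L1On t₀ t₁ Φ.1 ∧ L1On t₀ t₁ Φ.2.1 ∧
    ∃ (q : ℝ → Vec mb) (r : ℝ → Vec mg) (ζ : ℝ → Vec m),
      MdeltaWitness t₀ t₁ b g U C xb ub δ kψ x u θ Φ q r ζ}

/-- The conditions on an approximating sequence (xᵏ,uᵏ,θᵏ) in the weak outer limit. -/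
def ApproxConds (t₀ t₁ : ℝ) {n m mg : ℕ} (xb : W11 t₀ t₁ n) (ub : ℝ → Vec m)
    (x : ℕ → W11 t₀ t₁ n) (u : ℕ → ℝ → Vec m) (θ : ℕ → ℝ → Vec mg) : Prop :=
  (∀ k, L1On t₀ t₁ (u k)) ∧ (∀ k, L1On t₀ t₁ (θ k)) ∧
  (∀ k, AeOn t₀ t₁ (fun t => ∀ j, θ k t j ≤ 0)) ∧
  TendstoUniformlyOn (fun k => (x k).x) xb.x atTop (Set.Icc t₀ t₁) ∧
  Tendsto (fun k => ∫ t in Set.Icc t₀ t₁, ‖u k t - ub t‖) atTop (𝓝 0) ∧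
  AeOn t₀ t₁ (fun t => ∀ j, Tendsto (fun k => θ k t j) atTop (𝓝 0))

/-- The weak outer (Painlevé–Kuratowski) limit w-limsup_{x→x̄,u→ū,θ→0} ℳ_δ(x,u,θ). -/
def wLimsup (t₀ t₁ : ℝ) {n m mb mg : ℕ} (b : ℝ → Vec n × Vec m → Vec mb)
    (g : ℝ → Vec n × Vec m → Vec mg) (U : ℝ → Set (Vec m)) (C : Set (Vec n × Vec n))
    (xb : W11 t₀ t₁ n) (ub : ℝ → Vec m) (δ : ℝ) (kψ : ℝ → ℝ) :
    Set ((ℝ → Vec n) × (ℝ → Vec m) × Vec n × Vec n) :=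
  {Φ | ∃ (x : ℕ → W11 t₀ t₁ n) (u : ℕ → ℝ → Vec m) (θ : ℕ → ℝ → Vec mg)
        (φk : ℕ → ℝ → Vec n) (ψk : ℕ → ℝ → Vec m) (γk ξk : ℕ → Vec n),
      ApproxConds t₀ t₁ xb ub x u θ ∧
      (∀ k, (φk k, ψk k, γk k, ξk k) ∈
        Mdelta t₀ t₁ b g U C xb ub δ kψ (x k) (u k) (θ k)) ∧
      WeakL1Conv t₀ t₁ φk Φ.1 ∧ WeakL1Conv t₀ t₁ ψk Φ.2.1 ∧
      Tendsto (fun k => ((γk k, ξk k) : Vec n × Vec n)) atTop (𝓝 (Φ.2.2.1, Φ.2.2.2))}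

/-- AWMP-regularity (Definition 3.3). -/
def AWMPRegular (t₀ t₁ : ℝ) {n m mb mg : ℕ} (b : ℝ → Vec n × Vec m → Vec mb)
    (g : ℝ → Vec n × Vec m → Vec mg) (U : ℝ → Set (Vec m)) (C : Set (Vec n × Vec n))
    (xb : W11 t₀ t₁ n) (ub : ℝ → Vec m) : Prop :=
  ∃ δ > (0 : ℝ), ∃ kψ : ℝ → ℝ, IntegrableOn kψ (Set.Icc t₀ t₁) volume ∧
    wLimsup t₀ t₁ b g U C xb ub δ kψ ⊆
      Mdelta t₀ t₁ b g U C xb ub δ kψ xb ub (fun _ => 0)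

/-- Hypothesis (H8). -/
def Hyp8 (t₀ t₁ : ℝ) {n m : ℕ} (ε : ℕ → ℝ → Vec n) (η : ℕ → ℝ → Vec m) : Prop :=
  ∃ cε cη : ℝ → ℝ, IntegrableOn cε (Set.Icc t₀ t₁) volume ∧
    IntegrableOn cη (Set.Icc t₀ t₁) volume ∧
    ∀ k, AeOn t₀ t₁ (fun t => ‖ε k t‖ ≤ cε t ∧ ‖η k t‖ ≤ cη t)

/-- Hypothesis (H9). -/
def Hyp9 (t₀ t₁ : ℝ) {n m mb mg : ℕ} (b : ℝ → Vec n × Vec m → Vec mb)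
    (g : ℝ → Vec n × Vec m → Vec mg) (x : ℕ → W11 t₀ t₁ n) (u : ℕ → ℝ → Vec m)
    (q : ℕ → ℝ → Vec mb) (r : ℕ → ℝ → Vec mg) : Prop :=
  ∃ cφ : ℝ → ℝ, IntegrableOn cφ (Set.Icc t₀ t₁) volume ∧
    ∀ k, AeOn t₀ t₁ (fun t =>
      ‖(∑ i, q k t i • gradX (fun z => b t z i) ((x k).x t, u k t)) +
        ∑ j, r k t j • gradX (fun z => g t z j) ((x k).x t, u k t)‖ ≤ cφ t)

/-- Hypothesis (H10). -/
def Hyp10 (t₀ t₁ : ℝ) {n m mb mg : ℕ} (b : ℝ → Vec n × Vec m → Vec mb)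
    (g : ℝ → Vec n × Vec m → Vec mg) (xb : W11 t₀ t₁ n) (ub : ℝ → Vec m) (δ : ℝ) : Prop :=
  ∃ c : ℝ → ℝ, IntegrableOn c (Set.Icc t₀ t₁) volume ∧
    AeOn t₀ t₁ (fun t => ∀ z ∈ Metric.closedBall (xb.x t, ub t) δ,
      (∀ i, ‖gradU (fun w => b t w i) z‖ ≤ c t) ∧
      (∀ j, ‖gradU (fun w => g t w j) z‖ ≤ c t))

/-- The Asymptotic Calibrated Constraint Qualification (Definition 4.4), with δ explicit. -/
def ACCQ (t₀ t₁ : ℝ) {n m mb mg : ℕ} (b : ℝ → Vec n × Vec m → Vec mb)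
    (g : ℝ → Vec n × Vec m → Vec mg) (U : ℝ → Set (Vec m))
    (xb : W11 t₀ t₁ n) (ub : ℝ → Vec m) (δ : ℝ) : Prop :=
  ∃ M : ℝ → ℝ, IntegrableOn M (Set.Icc t₀ t₁) volume ∧
    ∀ (x : ℕ → W11 t₀ t₁ n) (u : ℕ → ℝ → Vec m) (q : ℕ → ℝ → Vec mb)
      (r : ℕ → ℝ → Vec mg) (ζ : ℕ → ℝ → Vec m) (φk : ℕ → ℝ → Vec n) (ψk : ℕ → ℝ → Vec m),
      (∀ k, L1On t₀ t₁ (u k)) → (∀ k, L1On t₀ t₁ (q k)) → (∀ k, L1On t₀ t₁ (r k)) →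
      (∀ k, L1On t₀ t₁ (ζ k)) →
      TendstoUniformlyOn (fun k => (x k).x) xb.x atTop (Set.Icc t₀ t₁) →
      Tendsto (fun k => ∫ t in Set.Icc t₀ t₁, ‖u k t - ub t‖) atTop (𝓝 0) →
      (∀ k, AeOn t₀ t₁ (fun t => ζ k t ∈ limNormal dotv (Udelta U ub δ t) (u k t))) →
      AeOn t₀ t₁ (fun t => ∀ j,
        Tendsto (fun k => r k t j * gneg g t ((x k).x t, u k t) j) atTop (𝓝 0)) →
      (∀ k, AeOn t₀ t₁ (fun t => ∀ j, r k t j ≤ 0)) →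
      (∀ k, AeOn t₀ t₁ (fun t =>
        ((φk k t, ψk k t) : Vec n × Vec m) =
          (∑ i, q k t i • gradFull (fun z => b t z i) ((x k).x t, u k t)) +
          (∑ j, r k t j • gradFull (fun z => g t z j) ((x k).x t, u k t)) +
          (0, -(ζ k t)))) →
      ∀ k, AeOn t₀ t₁ (fun t => ‖((q k t, r k t) : Vec mb × Vec mg)‖ ≤ M t * ‖ψk k t‖)

end

section Pairing

variable {n m : ℕ}

lemma dotv_add_left {d : ℕ} (a b c : Vec d) : dotv (a + b) c = dotv a c + dotv b c := by
  simp [dotv, add_mul, Finset.sum_add_distrib]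

lemma dotv_smul_left {d : ℕ} (s : ℝ) (a c : Vec d) : dotv (s • a) c = s * dotv a c := by
  simp [dotv, Finset.mul_sum, mul_assoc]

lemma dotv_comm {d : ℕ} (a b : Vec d) : dotv a b = dotv b a := by
  simp [dotv, mul_comm]

lemma abs_dotv_le {d : ℕ} (a b : Vec d) : |dotv a b| ≤ d * (‖a‖ * ‖b‖) := by
  calc |dotv a b| ≤ ∑ i, |a i * b i| := Finset.abs_sum_le_sum_abs _ _
    _ ≤ ∑ _i : Fin d, ‖a‖ * ‖b‖ := by
        refine Finset.sum_le_sum fun i _ => ?_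
        rw [abs_mul]
        exact mul_le_mul (norm_le_pi_norm a i) (norm_le_pi_norm b i) (abs_nonneg _) (norm_nonneg _)
    _ = d * (‖a‖ * ‖b‖) := by simp

lemma sq_norm_le_dotv_self {d : ℕ} (a : Vec d) : ‖a‖ ^ 2 ≤ dotv a a := by
  have h0 : 0 ≤ dotv a a := Finset.sum_nonneg fun i _ => mul_self_nonneg _
  have : ‖a‖ ≤ Real.sqrt (dotv a a) := by
    refine (pi_norm_le_iff_of_nonneg (Real.sqrt_nonneg _)).2 fun i => ?_
    refine Real.le_sqrt_of_sq_le ?_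
    rw [Real.norm_eq_abs, sq_abs, sq]
    exact Finset.single_le_sum (f := fun i => a i * a i) (fun i _ => mul_self_nonneg _)
      (Finset.mem_univ i)
  calc ‖a‖ ^ 2 ≤ Real.sqrt (dotv a a) ^ 2 := by gcongr
    _ = dotv a a := Real.sq_sqrt h0

/-- The duality pairing on `Vec n × Vec m`. -/
abbrev pairXU : Vec n × Vec m → Vec n × Vec m → ℝ := pairProd dotv dotv

lemma pairXU_add_left (a b c : Vec n × Vec m) :
    pairXU (a + b) c = pairXU a c + pairXU b c := by
  simp only [pairXU, pairProd, Prod.fst_add, Prod.snd_add, dotv_add_left]; ring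

lemma pairXU_smul_left (s : ℝ) (a c : Vec n × Vec m) : pairXU (s • a) c = s * pairXU a c := by
  simp only [pairXU, pairProd, Prod.smul_fst, Prod.smul_snd, dotv_smul_left]; ring

lemma pairXU_comm (a b : Vec n × Vec m) : pairXU a b = pairXU b a := by
  simp only [pairXU, pairProd, dotv_comm a.1, dotv_comm a.2]

lemma pairXU_add_right (a b c : Vec n × Vec m) :
    pairXU a (b + c) = pairXU a b + pairXU a c := by
  rw [pairXU_comm, pairXU_add_left, pairXU_comm b, pairXU_comm c]

lemma pairXU_smul_right (s : ℝ) (a c : Vec n × Vec m) : pairXU a (s • c) = s * pairXU a c := by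
  rw [pairXU_comm, pairXU_smul_left, pairXU_comm c]

lemma pairXU_neg_left (a c : Vec n × Vec m) : pairXU (-a) c = -pairXU a c := by
  simpa using pairXU_smul_left (-1) a c

lemma pairXU_neg_right (a c : Vec n × Vec m) : pairXU a (-c) = -pairXU a c := by
  simpa using pairXU_smul_right (-1) a c

lemma pairXU_sub_left (a b c : Vec n × Vec m) :
    pairXU (a - b) c = pairXU a c - pairXU b c := by
  rw [sub_eq_add_neg, pairXU_add_left, pairXU_neg_left, sub_eq_add_neg]

lemma pairXU_sub_right (a b c : Vec n × Vec m) :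
    pairXU a (b - c) = pairXU a b - pairXU a c := by
  rw [sub_eq_add_neg, pairXU_add_right, pairXU_neg_right, sub_eq_add_neg]

lemma abs_pairXU_le (a b : Vec n × Vec m) : |pairXU a b| ≤ (n + m) * (‖a‖ * ‖b‖) := by
  have h1 := abs_dotv_le a.1 b.1
  have h2 := abs_dotv_le a.2 b.2
  have h3 : ‖a.1‖ * ‖b.1‖ ≤ ‖a‖ * ‖b‖ :=
    mul_le_mul (norm_fst_le a) (norm_fst_le b) (norm_nonneg _) (norm_nonneg _)
  have h4 : ‖a.2‖ * ‖b.2‖ ≤ ‖a‖ * ‖b‖ :=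
    mul_le_mul (norm_snd_le a) (norm_snd_le b) (norm_nonneg _) (norm_nonneg _)
  calc |pairXU a b| ≤ |dotv a.1 b.1| + |dotv a.2 b.2| := abs_add_le _ _
    _ ≤ n * (‖a‖ * ‖b‖) + m * (‖a‖ * ‖b‖) :=
        add_le_add (h1.trans (by gcongr)) (h2.trans (by gcongr))
    _ = _ := by ring

lemma pairXU_le (a b : Vec n × Vec m) : pairXU a b ≤ (n + m) * (‖a‖ * ‖b‖) :=
  (le_abs_self _).trans (abs_pairXU_le a b)

lemma sq_norm_le_pairXU_self (a : Vec n × Vec m) : ‖a‖ ^ 2 ≤ pairXU a a := by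
  have h1 := sq_norm_le_dotv_self a.1
  have h2 := sq_norm_le_dotv_self a.2
  have h3 := sq_nonneg ‖a.1‖
  have h4 := sq_nonneg ‖a.2‖
  simp only [pairXU, pairProd, Prod.norm_def]
  rcases max_cases ‖a.1‖ ‖a.2‖ with h | h <;> rw [h.1] <;> linarith

lemma continuous_pairXU : Continuous fun p : (Vec n × Vec m) × (Vec n × Vec m) =>
    pairXU p.1 p.2 := by
  unfold pairXU pairProd dotv
  fun_prop

lemma pairXU_gradFull (h : Vec n × Vec m → ℝ) (z w : Vec n × Vec m) :
    pairXU (gradFull h z) w = fderiv ℝ h z w := by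
  have hw : w = (∑ i, w.1 i • ((Pi.single i 1, 0) : Vec n × Vec m)) +
      ∑ j, w.2 j • ((0, Pi.single j 1) : Vec n × Vec m) := by
    ext i
    · simp [Prod.fst_sum, Finset.sum_apply, Pi.single_apply]
    · simp [Prod.snd_sum, Finset.sum_apply, Pi.single_apply]
  conv_rhs => rw [hw]
  simp only [pairXU, pairProd, dotv, gradFull, map_add, map_sum, map_smul, smul_eq_mul]
  congr 1 <;> exact Finset.sum_congr rfl fun i _ => mul_comm _ _

lemma continuousAt_gradFull {h : Vec n × Vec m → ℝ} {z : Vec n × Vec m}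
    (hh : ContDiffAt ℝ 1 h z) : ContinuousAt (gradFull h) z := by
  have h1 : ContinuousAt (fderiv ℝ h) z := (hh.fderiv_right (m := 0) (by norm_num)).continuousAt
  unfold gradFull
  refine ContinuousAt.prodMk ?_ ?_ <;>
    exact continuousAt_pi.2 fun i => h1.clm_apply continuousAt_const

end Pairing

section Subdifferential

variable {n m : ℕ}

/-- `ξ` is a limit of proximal subgradients of `φ` at points converging to `z`. -/
def IsLimitProx (φ : Vec n × Vec m → ℝ) (z ξ : Vec n × Vec m) : Prop :=
  ∀ ε > 0, ∃ (x ξ' : Vec n × Vec m) (M ρ : ℝ), 0 ≤ M ∧ 0 < ρ ∧ ‖x - z‖ < ε ∧ ‖ξ' - ξ‖ < ε ∧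
    ∀ y, ‖y - x‖ < ρ → pairXU ξ' (y - x) ≤ φ y - φ x + M * ‖y - x‖ ^ 2

lemma isLimitProx_of_mem_limSubdiff {φ : Vec n × Vec m → ℝ} {z ξ : Vec n × Vec m}
    {K : NNReal} {s : Set (Vec n × Vec m)} (hs : s ∈ 𝓝 z) (hφ : LipschitzOnWith K φ s)
    (hξ : ξ ∈ limSubdiff pairXU φ z) : IsLimitProx φ z ξ := by
  obtain ⟨v, w, M, hv, hw, hwS, hM, hin⟩ := hξ
  intro ε hε
  have hv1 : Tendsto (fun k => (v k).1) atTop (𝓝 ξ) := (continuous_fst.tendsto _).comp hv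
  have hv2 : Tendsto (fun k => (v k).2) atTop (𝓝 (-1)) := (continuous_snd.tendsto _).comp hv
  have hw1 : Tendsto (fun k => (w k).1) atTop (𝓝 z) := (continuous_fst.tendsto _).comp hw
  have hq : Tendsto (fun k => (-(v k).2)⁻¹ • (v k).1) atTop (𝓝 ξ) := by
    have := (hv2.neg.inv₀ (by norm_num)).smul hv1
    simpa using this
  obtain ⟨k, hk1, hk2, hk3, hk4⟩ := ((hv2.eventually (gt_mem_nhds (show (-1 : ℝ) < 0 by norm_num))).and
    ((Metric.tendsto_nhds.1 hw1 ε hε).and ((Metric.tendsto_nhds.1 hq ε hε).and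
      (hw1.eventually (eventually_mem_nhds_iff.2 hs))))).exists
  obtain ⟨ρ, hρ, hball⟩ := Metric.mem_nhds_iff.1 hk4
  set a := (v k).1
  set β := -(v k).2 with hβ
  set x := (w k).1
  have hβpos : 0 < β := by simp only [hβ]; linarith
  have hwk : (w k).2 = φ x := by
    have hle : φ x ≤ (w k).2 := hwS k
    by_contra hne
    have hlt : 0 < (w k).2 - φ x := sub_pos.2 (lt_of_le_of_ne hle (Ne.symm hne))
    set τ := min ((w k).2 - φ x) (β / (2 * (M k + 1)))
    have hMk := hM k
    have hτ : 0 < τ := lt_min hlt (by positivity)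
    have h1 := hin k (x, (w k).2 - τ) (by
      show φ x ≤ (w k).2 - τ
      linarith [min_le_left ((w k).2 - φ x) (β / (2 * (M k + 1)))])
    have h2 : ((x, (w k).2 - τ) : (Vec n × Vec m) × ℝ) - w k = (0, -τ) := by
      ext1 <;> simp [x]
    rw [h2] at h1
    have h3 : ‖((0, -τ) : (Vec n × Vec m) × ℝ)‖ = τ := by
      rw [Prod.norm_def]; simp [abs_of_pos hτ, hτ.le]
    rw [h3] at h1
    have h0 : pairXU a 0 = 0 := by simpa using pairXU_smul_right 0 a 0
    have h4 : β * τ ≤ M k * τ ^ 2 := by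
      simp only [pairProd, pairR] at h1 h0
      simp only [hβ]
      nlinarith [h1, h0]
    have h5 : β ≤ M k * τ := by
      have : β * τ ≤ M k * τ * τ := by linarith [h4, sq τ, mul_assoc (M k) τ τ]
      exact le_of_mul_le_mul_right this hτ
    have h6 : τ * (2 * (M k + 1)) ≤ β :=
      (le_div_iff₀ (by positivity)).1 (min_le_right _ _)
    nlinarith
  refine ⟨x, β⁻¹ • a, β⁻¹ * (M k * (1 + K) ^ 2), ρ, ?_, hρ, ?_, ?_, ?_⟩
  · have := hM k
    positivity
  · rw [← dist_eq_norm]; exact hk2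
  · rw [← dist_eq_norm]; exact hk3
  · intro y hy
    have h1 := hin k (y, φ y) (le_refl (φ y))
    have h2 : ((y, φ y) : (Vec n × Vec m) × ℝ) - w k = (y - x, φ y - φ x) := by
      rw [← hwk]; rfl
    rw [h2] at h1
    have hL : |φ y - φ x| ≤ K * ‖y - x‖ := by
      have := hφ.dist_le_mul y (hball (by simpa [dist_eq_norm] using hy)) x
        (hball (Metric.mem_ball_self hρ))
      rwa [Real.dist_eq, dist_eq_norm] at this
    have h3 : ‖((y - x, φ y - φ x) : (Vec n × Vec m) × ℝ)‖ ≤ (1 + K) * ‖y - x‖ := by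
      rw [Prod.norm_def]
      have := norm_nonneg (y - x)
      have hK : (0 : ℝ) ≤ K := K.2
      refine max_le ?_ ?_
      · simp only; nlinarith
      · simp only [Real.norm_eq_abs]; linarith
    have h4 : pairXU a (y - x) - β * (φ y - φ x) ≤ M k * ((1 + K) * ‖y - x‖) ^ 2 := by
      have h5 : M k * ‖((y - x, φ y - φ x) : (Vec n × Vec m) × ℝ)‖ ^ 2 ≤
          M k * ((1 + K) * ‖y - x‖) ^ 2 := by
        have := hM k
        gcongr
      refine le_trans ?_ (h1.trans h5)
      simp only [pairProd, pairR, hβ, a]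
      linarith
    rw [pairXU_smul_left]
    have h6 := mul_le_mul_of_nonneg_left h4 (inv_pos.2 hβpos).le
    have h7 : β⁻¹ * β = 1 := inv_mul_cancel₀ hβpos.ne'
    have h8 : β⁻¹ * (pairXU a (y - x) - β * (φ y - φ x)) =
      β⁻¹ * pairXU a (y - x) - (β⁻¹ * β) * (φ y - φ x) := by ring
    rw [h8, h7] at h6
    nlinarith

lemma IsLimitProx.mem_limSubdiff {φ : Vec n × Vec m → ℝ} {z ξ : Vec n × Vec m}
    (hφ : ContinuousAt φ z) (h : IsLimitProx φ z ξ) : ξ ∈ limSubdiff pairXU φ z := by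
  choose x ξ' M ρ hM hρ hx hξ hin using
    fun k : ℕ => h (1 / ((k : ℝ) + 1)) Nat.one_div_pos_of_nat
  have hx' : Tendsto x atTop (𝓝 z) := by
    rw [tendsto_iff_norm_sub_tendsto_zero]
    exact squeeze_zero (fun _ => norm_nonneg _) (fun k => (hx k).le)
      tendsto_one_div_add_atTop_nhds_zero_nat
  have hξ' : Tendsto ξ' atTop (𝓝 ξ) := by
    rw [tendsto_iff_norm_sub_tendsto_zero]
    exact squeeze_zero (fun _ => norm_nonneg _) (fun k => (hξ k).le)
      tendsto_one_div_add_atTop_nhds_zero_nat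
  refine ⟨fun k => (ξ' k, -1), fun k => (x k, φ (x k)),
    fun k => M k + ((n + m) * ‖ξ' k‖ + 1) / ρ k, hξ'.prodMk_nhds tendsto_const_nhds,
    hx'.prodMk_nhds (hφ.tendsto.comp hx'), fun k => le_refl (φ (x k)), fun k => ?_, fun k => ?_⟩
  · have := hM k
    have := hρ k
    positivity
  · rintro ⟨y, α⟩ hy
    have hα : φ y ≤ α := hy
    have hMk := hM k
    have hρk := hρ k
    have hn1 : ‖y - x k‖ ≤ ‖((y, α) : (Vec n × Vec m) × ℝ) - (x k, φ (x k))‖ :=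
      norm_fst_le (((y, α) : (Vec n × Vec m) × ℝ) - (x k, φ (x k)))
    have hn2 : |α - φ (x k)| ≤ ‖((y, α) : (Vec n × Vec m) × ℝ) - (x k, φ (x k))‖ :=
      norm_snd_le (((y, α) : (Vec n × Vec m) × ℝ) - (x k, φ (x k)))
    set N := ‖((y, α) : (Vec n × Vec m) × ℝ) - (x k, φ (x k))‖
    have hN : 0 ≤ N := norm_nonneg _
    have hc : 0 ≤ ((n + m) * ‖ξ' k‖ + 1) / ρ k := by positivity
    show pairXU (ξ' k) (y - x k) + (-1) * (α - φ (x k)) ≤ _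
    rcases lt_or_ge ‖y - x k‖ (ρ k) with hlt | hge
    · have h1 := hin k y hlt
      have h2 : M k * ‖y - x k‖ ^ 2 ≤ M k * N ^ 2 := by gcongr
      nlinarith [mul_nonneg hc (sq_nonneg N)]
    · have h1 := pairXU_le (ξ' k) (y - x k)
      have h2 : ((n : ℝ) + m) * (‖ξ' k‖ * ‖y - x k‖) ≤ (n + m) * (‖ξ' k‖ * N) := by gcongr
      have h3 : ((n + m) * ‖ξ' k‖ + 1) * N ≤ ((n + m) * ‖ξ' k‖ + 1) / ρ k * N ^ 2 := by
        rw [div_mul_eq_mul_div, le_div_iff₀ hρk, mul_assoc]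
        refine mul_le_mul_of_nonneg_left ?_ (by positivity)
        nlinarith
      nlinarith [neg_abs_le (α - φ (x k)), mul_nonneg hMk (sq_nonneg N)]

/-- A Fréchet subgradient is a limit of proximal subgradients at nearby points. -/
lemma exists_proximal_of_frechet {φ : Vec n × Vec m → ℝ} {x η : Vec n × Vec m} {ε r : ℝ}
    (hε : 0 < ε) (hr : 0 < r) (hc : ContinuousOn φ (Metric.closedBall x r))
    (hF : ∀ y ∈ Metric.closedBall x r, pairXU η (y - x) ≤ φ y - φ x + ε * ‖y - x‖) :
    ∃ (y₀ η' : Vec n × Vec m) (M ρ : ℝ), 0 ≤ M ∧ 0 < ρ ∧ ‖y₀ - x‖ < r ∧ ‖η' - η‖ ≤ 2 * ε ∧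
      ∀ y, ‖y - y₀‖ < ρ → pairXU η' (y - y₀) ≤ φ y - φ y₀ + M * ‖y - y₀‖ ^ 2 := by
  -- `c` is the weight of the quadratic penalty
  set c : ℝ := 2 * ε / r with hcdef
  have hcpos : 0 < c := by positivity
  have hG : ContinuousOn (fun y => φ y - pairXU η (y - x) + c * pairXU (y - x) (y - x))
      (Metric.closedBall x r) := by
    have h1 : Continuous fun y => pairXU η (y - x) :=
      continuous_pairXU.comp (continuous_const.prodMk (continuous_id.sub continuous_const))
    have h2 : Continuous fun y => pairXU (y - x) (y - x) :=
      continuous_pairXU.comp ((continuous_id.sub continuous_const).prodMk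
        (continuous_id.sub continuous_const))
    exact (hc.sub h1.continuousOn).add (continuous_const.mul h2).continuousOn
  obtain ⟨y₀, hy₀, hmin⟩ := (isCompact_closedBall x r).exists_isMinOn
    ⟨x, Metric.mem_closedBall_self hr.le⟩ hG
  have hxx : ∀ a : Vec n × Vec m, pairXU a (x - x) = 0 := fun a => by
    rw [pairXU_sub_right, sub_self]
  have h0 := hmin (Metric.mem_closedBall_self hr.le : x ∈ Metric.closedBall x r)
  simp only [mem_ofPred_eq, hxx] at h0
  have h1 := hF y₀ hy₀
  have h2 := sq_norm_le_pairXU_self (y₀ - x)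
  have h3 : c * ‖y₀ - x‖ ≤ ε := by
    by_contra hcon
    push Not at hcon
    have hpos : 0 < ‖y₀ - x‖ := by
      rcases (norm_nonneg (y₀ - x)).eq_or_lt with h | h
      · rw [← h] at hcon; linarith
      · exact h
    have h4 : c * ‖y₀ - x‖ ^ 2 ≤ c * pairXU (y₀ - x) (y₀ - x) := by gcongr
    nlinarith
  have h5 : ‖y₀ - x‖ < r := by
    have : c * ‖y₀ - x‖ < c * r := by
      rw [hcdef, div_mul_cancel₀ _ hr.ne']
      calc _ ≤ ε := h3
        _ < 2 * ε := by linarith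
    exact lt_of_mul_lt_mul_left this hcpos.le
  refine ⟨y₀, η - (2 * c) • (y₀ - x), c * (n + m), r - ‖y₀ - x‖, by positivity, by linarith, h5,
    ?_, fun y hy => ?_⟩
  · rw [sub_sub_cancel_left, norm_neg, norm_smul, Real.norm_eq_abs, abs_of_pos (by positivity)]
    nlinarith
  · have hyb : y ∈ Metric.closedBall x r := by
      rw [mem_closedBall_iff_norm]
      have : ‖y - x‖ ≤ ‖y - y₀‖ + ‖y₀ - x‖ := by
        simpa using norm_add_le (y - y₀) (y₀ - x)
      linarith
    have h6 := hmin hyb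
    simp only [mem_ofPred_eq] at h6
    have h7 := pairXU_le (y - y₀) (y - y₀)
    have h8 : y - x = (y - y₀) + (y₀ - x) := by abel
    rw [h8] at h6
    simp only [pairXU_add_left, pairXU_add_right, pairXU_comm (y₀ - x) (y - y₀)] at h6
    rw [pairXU_sub_left, pairXU_smul_left, pairXU_comm (y₀ - x)]
    have h9 := mul_le_mul_of_nonneg_left h7 hcpos.le
    nlinarith

lemma IsLimitProx.add_smooth {φ h : Vec n × Vec m → ℝ} {z ξ : Vec n × Vec m}
    {s : Set (Vec n × Vec m)} (hs : s ∈ 𝓝 z) (hφ : ContinuousOn φ s) (hh : ContDiffAt ℝ 1 h z)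
    (H : IsLimitProx φ z ξ) : IsLimitProx (fun y => φ y + h y) z (ξ + gradFull h z) := by
  intro ε hε
  have hev : ∀ᶠ x in 𝓝 z, s ∈ 𝓝 x ∧ ContDiffAt ℝ 1 h x ∧
      ‖gradFull h x - gradFull h z‖ < ε / 4 := by
    refine (eventually_mem_nhds_iff.2 hs).and ((hh.eventually (by simp)).and ?_)
    have := Metric.tendsto_nhds.1 (continuousAt_gradFull hh) (ε / 4) (by positivity)
    simpa [dist_eq_norm] using this
  obtain ⟨ε₁, hε₁, hball⟩ := Metric.eventually_nhds_iff.1 hev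
  obtain ⟨x, ξ', M, ρ, hM, hρ, hx, hξ', hin⟩ := H (min ε₁ (ε / 4)) (by positivity)
  obtain ⟨hsx, hhx, hgx⟩ := hball (y := x) (by
    rw [dist_eq_norm]; exact hx.trans_le (min_le_left _ _))
  have hxε := hx.trans_le (min_le_right _ _)
  have hξε := hξ'.trans_le (min_le_right _ _)
  have hd : HasFDerivAt h (fderiv ℝ h x) x := (hhx.differentiableAt (by norm_num)).hasFDerivAt
  have hcont : ∀ᶠ y in 𝓝 x, ContDiffAt ℝ 1 h y := hhx.eventually (by simp)
  obtain ⟨r₁, hr₁, hb₁⟩ := Metric.eventually_nhds_iff.1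
    ((hd.isLittleO.def (show 0 < ε / 8 by positivity)).and (hcont.and hsx))
  set r := min (min (r₁ / 2) (ρ / 2)) (min (ε / 8 / (M + 1)) (ε / 4)) with hrdef
  have hr : 0 < r := by positivity
  have hr1 : r ≤ r₁ / 2 := (min_le_left _ _).trans (min_le_left _ _)
  have hr2 : r ≤ ρ / 2 := (min_le_left _ _).trans (min_le_right _ _)
  have hr3 : r ≤ ε / 8 / (M + 1) := (min_le_right _ _).trans (min_le_left _ _)
  have hr4 : r ≤ ε / 4 := (min_le_right _ _).trans (min_le_right _ _)
  have hlt : ∀ y ∈ Metric.closedBall x r, dist y x < r₁ := fun y hy => by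
    have := Metric.mem_closedBall.1 hy
    linarith
  obtain ⟨y₀, η', M', ρ', hM', hρ', hy₀, hη', hin'⟩ := exists_proximal_of_frechet
    (φ := fun y => φ y + h y) (x := x) (η := ξ' + gradFull h x) (ε := ε / 4) (r := r)
    (by positivity) hr
    (fun y hy => ((hφ.mono fun w hw => (hb₁ (hlt w hw)).2.2) y hy).add
      (hb₁ (hlt y hy)).2.1.continuousAt.continuousWithinAt)
    (fun y hy => by
      have hyr : ‖y - x‖ ≤ r := mem_closedBall_iff_norm.1 hy
      have h1 := hin y (by linarith)
      have h2 := (hb₁ (hlt y hy)).1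
      rw [Real.norm_eq_abs] at h2
      have h3 := (abs_le.1 h2).1
      rw [pairXU_add_left, pairXU_gradFull]
      have h4 : M * ‖y - x‖ ^ 2 ≤ ε / 8 * ‖y - x‖ := by
        have h5 : r * (M + 1) ≤ ε / 8 := (le_div_iff₀ (by positivity)).1 hr3
        have h6 : M * ‖y - x‖ ≤ ε / 8 := by nlinarith [norm_nonneg (y - x)]
        nlinarith [norm_nonneg (y - x)]
      linarith)
  refine ⟨y₀, η', M', ρ', hM', hρ', ?_, ?_, hin'⟩
  · have : ‖y₀ - z‖ ≤ ‖y₀ - x‖ + ‖x - z‖ := by simpa using norm_add_le (y₀ - x) (x - z)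
    linarith
  · have h1 : η' - (ξ + gradFull h z) = (η' - (ξ' + gradFull h x)) +
        ((ξ' - ξ) + (gradFull h x - gradFull h z)) := by abel
    rw [h1]
    have h2 := norm_add_le (η' - (ξ' + gradFull h x)) ((ξ' - ξ) + (gradFull h x - gradFull h z))
    have h3 := norm_add_le (ξ' - ξ) (gradFull h x - gradFull h z)
    linarith

lemma limSubdiff_add_smooth_subset {φ h : Vec n × Vec m → ℝ} {z ξ : Vec n × Vec m}
    {K : NNReal} {s : Set (Vec n × Vec m)} (hs : s ∈ 𝓝 z) (hφ : LipschitzOnWith K φ s)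
    (hh : ContDiffAt ℝ 1 h z) (hξ : ξ ∈ limSubdiff pairXU φ z) :
    ξ + gradFull h z ∈ limSubdiff pairXU (fun y => φ y + h y) z :=
  ((isLimitProx_of_mem_limSubdiff hs hφ hξ).add_smooth hs hφ.continuousOn hh).mem_limSubdiff
    ((hφ.continuousOn.continuousAt hs).add hh.continuousAt)

lemma gradFull_neg (h : Vec n × Vec m → ℝ) (z : Vec n × Vec m) :
    gradFull (fun y => -h y) z = -gradFull h z := by
  unfold gradFull
  rw [fderiv_fun_neg]
  rfl

lemma limSubdiff_add_smooth {φ h : Vec n × Vec m → ℝ} {z : Vec n × Vec m}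
    {K : NNReal} {s : Set (Vec n × Vec m)} (hs : s ∈ 𝓝 z) (hφ : LipschitzOnWith K φ s)
    (hh : ContDiffAt ℝ 1 h z) :
    limSubdiff pairXU (fun y => φ y + h y) z = limSubdiff pairXU φ z + {gradFull h z} := by
  ext ξ
  rw [add_singleton, mem_image]
  constructor
  · intro hξ
    obtain ⟨K', s', hs', hK'⟩ := hh.exists_lipschitzOnWith
    have h1 := limSubdiff_add_smooth_subset (inter_mem hs hs')
      ((hφ.mono inter_subset_left).add (hK'.mono inter_subset_right)) hh.neg hξ
    refine ⟨ξ + gradFull (fun y => -h y) z, by simpa using h1, ?_⟩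
    rw [gradFull_neg]; abel
  · rintro ⟨ξ, hξ, rfl⟩
    exact limSubdiff_add_smooth_subset hs hφ hh hξ

lemma mem_clarke_add_smooth_iff {φ h : Vec n × Vec m → ℝ} {z ξ : Vec n × Vec m}
    {K : NNReal} {s : Set (Vec n × Vec m)} (hs : s ∈ 𝓝 z) (hφ : LipschitzOnWith K φ s)
    (hh : ContDiffAt ℝ 1 h z) :
    ξ ∈ clarke pairXU (fun y => φ y + h y) z ↔ ξ - gradFull h z ∈ clarke pairXU φ z := by
  unfold clarke
  rw [limSubdiff_add_smooth hs hφ hh, convexHull_add, convexHull_singleton, add_singleton,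
    mem_image]
  constructor
  · rintro ⟨w, hw, rfl⟩
    simpa using hw
  · intro hw
    exact ⟨_, hw, by simp⟩

lemma IsLimitProx.norm_le {φ : Vec n × Vec m → ℝ} {z ξ : Vec n × Vec m}
    {K : NNReal} {s : Set (Vec n × Vec m)} (hs : s ∈ 𝓝 z) (hφ : LipschitzOnWith K φ s)
    (H : IsLimitProx φ z ξ) : ‖ξ‖ ≤ K := by
  obtain ⟨r, hr, hball⟩ := Metric.mem_nhds_iff.1 hs
  refine le_of_forall_pos_le_add fun ε hε => ?_
  obtain ⟨x, ξ', M, ρ, hM, hρ, hx, hξ', hin⟩ := H (min (ε / 2) (r / 2)) (by positivity)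
  have hxr := hx.trans_le (min_le_right _ _)
  have hξε := hξ'.trans_le (min_le_left _ _)
  have hxs : x ∈ s := hball (by rw [mem_ball_iff_norm]; linarith)
  have key : ∀ e : Vec n × Vec m, ‖e‖ ≤ 1 → pairXU ξ' e ≤ K + ε / 2 := by
    intro e he
    set τ := min (ρ / 2) (min (r / 4) (ε / 2 / (M + 1)))
    have hτ : 0 < τ := by positivity
    have hτ1 : τ ≤ ρ / 2 := min_le_left _ _
    have hτ2 : τ ≤ r / 4 := (min_le_right _ _).trans (min_le_left _ _)
    have hτ3 : τ * (M + 1) ≤ ε / 2 :=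
      (le_div_iff₀ (by positivity)).1 ((min_le_right _ _).trans (min_le_right _ _))
    have hn : ‖τ • e‖ ≤ τ := by
      rw [norm_smul, Real.norm_eq_abs, abs_of_pos hτ]; nlinarith
    have h1 := hin (x + τ • e) (by rw [add_sub_cancel_left]; linarith)
    have hys : x + τ • e ∈ s := hball (by
      rw [mem_ball_iff_norm]
      have h2 : x + τ • e - z = (x - z) + τ • e := by abel
      rw [h2]
      have := norm_add_le (x - z) (τ • e)
      linarith)
    have h3 := hφ.dist_le_mul _ hys _ hxs
    rw [Real.dist_eq, dist_eq_norm, add_sub_cancel_left] at h3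
    rw [add_sub_cancel_left, pairXU_smul_right] at h1
    have h4 : (K : ℝ) * ‖τ • e‖ ≤ K * τ := by gcongr
    have h5 : M * ‖τ • e‖ ^ 2 ≤ M * τ ^ 2 := by gcongr
    have h6 := le_abs_self (φ (x + τ • e) - φ x)
    have h7 : τ * pairXU ξ' e ≤ τ * (K + ε / 2) := by nlinarith
    exact le_of_mul_le_mul_left h7 hτ
  have hKε : (0 : ℝ) ≤ K + ε / 2 := by positivity
  have hξK : ‖ξ'‖ ≤ K + ε / 2 := by
    rw [Prod.norm_def]
    refine max_le ((pi_norm_le_iff_of_nonneg hKε).2 fun i => ?_)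
      ((pi_norm_le_iff_of_nonneg hKε).2 fun i => ?_)
    · have he : ‖((Pi.single i 1, 0) : Vec n × Vec m)‖ ≤ 1 := by
        rw [Prod.norm_def]; simp [Pi.norm_single]
      have h1 := key _ he
      have h2 := key (-(Pi.single i 1, 0)) (by rwa [norm_neg])
      rw [pairXU_neg_right] at h2
      have h3 : pairXU ξ' (Pi.single i 1, 0) = ξ'.1 i := by
        simp [pairXU, pairProd, dotv, Pi.single_apply]
      rw [h3] at h1 h2
      rw [Real.norm_eq_abs]
      exact abs_le.2 ⟨by linarith, h1⟩
    · have he : ‖((0, Pi.single i 1) : Vec n × Vec m)‖ ≤ 1 := by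
        rw [Prod.norm_def]; simp [Pi.norm_single]
      have h1 := key _ he
      have h2 := key (-(0, Pi.single i 1)) (by rwa [norm_neg])
      rw [pairXU_neg_right] at h2
      have h3 : pairXU ξ' (0, Pi.single i 1) = ξ'.2 i := by
        simp [pairXU, pairProd, dotv, Pi.single_apply]
      rw [h3] at h1 h2
      rw [Real.norm_eq_abs]
      exact abs_le.2 ⟨by linarith, h1⟩
  have h1 : ‖ξ‖ ≤ ‖ξ'‖ + ‖ξ' - ξ‖ := by
    simpa using norm_sub_le ξ' (ξ' - ξ)
  linarith

lemma norm_le_of_mem_clarke {φ : Vec n × Vec m → ℝ} {z ξ : Vec n × Vec m}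
    {K : NNReal} {s : Set (Vec n × Vec m)} (hs : s ∈ 𝓝 z) (hφ : LipschitzOnWith K φ s)
    (hξ : ξ ∈ clarke pairXU φ z) : ‖ξ‖ ≤ K := by
  have h : clarke pairXU φ z ⊆ Metric.closedBall 0 K :=
    convexHull_min (fun w hw => mem_closedBall_zero_iff.2
      ((isLimitProx_of_mem_limSubdiff hs hφ hw).norm_le hs hφ)) (convex_closedBall _ _)
  exact mem_closedBall_zero_iff.1 (h hξ)

end Subdifferential

section NormalCone

lemma limNormal_convex {d : ℕ} {S : Set (Vec d)} (hS : Convex ℝ S) {x : Vec d} (hx : x ∈ S) :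
    limNormal dotv S x = {v | ∀ y ∈ S, dotv v (y - x) ≤ 0} := by
  ext v
  constructor
  · rintro ⟨vk, zk, M, hv, hz, hzS, hM, hin⟩ y hy
    have hk : ∀ k, dotv (vk k) (y - zk k) ≤ 0 := by
      intro k
      by_contra! hcon
      set A := dotv (vk k) (y - zk k)
      set B := M k * ‖y - zk k‖ ^ 2
      have hB : 0 ≤ B := mul_nonneg (hM k) (sq_nonneg _)
      set τ := min 1 (A / (2 * (B + 1)))
      have hτ : 0 < τ := by positivity
      have hτ1 : τ ≤ 1 := min_le_left _ _
      have hτ2 : τ * (2 * (B + 1)) ≤ A := (le_div_iff₀ (by positivity)).1 (min_le_right _ _)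
      have h1 := hin k (zk k + τ • (y - zk k)) (hS.add_smul_sub_mem (hzS k) hy ⟨hτ.le, hτ1⟩)
      rw [add_sub_cancel_left, dotv_comm, dotv_smul_left, dotv_comm, norm_smul, mul_pow,
        Real.norm_eq_abs, sq_abs] at h1
      have h2 : τ * A ≤ τ * (τ * B) := by
        have h3 : M k * (τ ^ 2 * ‖y - zk k‖ ^ 2) = τ * (τ * B) := by simp only [B]; ring
        rw [← h3]; exact h1
      have h4 : A ≤ τ * B := le_of_mul_le_mul_left h2 hτ
      nlinarith
    have hc : Continuous fun p : Vec d × Vec d => dotv p.1 p.2 := by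
      unfold dotv; fun_prop
    have hlim : Tendsto (fun k => dotv (vk k) (y - zk k)) atTop (𝓝 (dotv v (y - x))) :=
      (hc.tendsto (v, y - x)).comp (hv.prodMk_nhds (tendsto_const_nhds.sub hz))
    exact le_of_tendsto' hlim hk
  · intro hv
    refine ⟨fun _ => v, fun _ => x, fun _ => 0, tendsto_const_nhds, tendsto_const_nhds,
      fun _ => hx, fun _ => le_rfl, fun _ y hy => ?_⟩
    simpa using hv y hy

lemma convexHull_limNormal_of_convex {d : ℕ} {S : Set (Vec d)} (hS : Convex ℝ S) {x : Vec d}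
    (hx : x ∈ S) : convexHull ℝ (limNormal dotv S x) = limNormal dotv S x := by
  rw [limNormal_convex hS hx]
  refine Convex.convexHull_eq fun v hv w hw a c ha hc _ y hy => ?_
  rw [dotv_add_left, dotv_smul_left, dotv_smul_left]
  have := hv y hy
  have := hw y hy
  nlinarith

/-- The limiting normal cone at `x` only depends on the set near `x`. -/
lemma limNormal_closedBall_inter {d : ℕ} {S : Set (Vec d)} {x : Vec d} {δ : ℝ} (hδ : 0 < δ) :
    limNormal dotv (Metric.closedBall x δ ∩ S) x = limNormal dotv S x := by
  ext v
  constructor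
  · rintro ⟨vk, zk, M, hv, hz, hzS, hM, hin⟩
    obtain ⟨N, hN⟩ := eventually_atTop.1 (Metric.tendsto_nhds.1 hz (δ / 2) (by positivity))
    refine ⟨fun k => vk (k + N), fun k => zk (k + N),
      fun k => M (k + N) + d * ‖vk (k + N)‖ / (δ / 2), hv.comp (tendsto_add_atTop_nat N),
      hz.comp (tendsto_add_atTop_nat N), fun k => (hzS _).2, fun k => ?_, fun k y hy => ?_⟩
    · have := hM (k + N)
      positivity
    · have hMk := hM (k + N)
      have hzk := hN (k + N) (Nat.le_add_left _ _)
      simp only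
      set w := vk (k + N)
      set z := zk (k + N)
      have hc : 0 ≤ d * ‖w‖ / (δ / 2) := by positivity
      rcases lt_or_ge ‖y - z‖ (δ / 2) with hlt | hge
      · have hyb : y ∈ Metric.closedBall x δ := by
          have := dist_triangle y z x
          rw [dist_eq_norm y z] at this
          rw [Metric.mem_closedBall]
          linarith
        have := hin (k + N) y ⟨hyb, hy⟩
        nlinarith [mul_nonneg hc (sq_nonneg ‖y - z‖)]
      · have h1 := (le_abs_self _).trans (abs_dotv_le w (y - z))
        have h2 : d * ‖w‖ * ‖y - z‖ ≤ d * ‖w‖ / (δ / 2) * ‖y - z‖ ^ 2 := by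
          rw [div_mul_eq_mul_div, le_div_iff₀ (by positivity), mul_assoc]
          refine mul_le_mul_of_nonneg_left ?_ (by positivity)
          nlinarith
        nlinarith [mul_nonneg hMk (sq_nonneg ‖y - z‖)]
  · rintro ⟨vk, zk, M, hv, hz, hzS, hM, hin⟩
    obtain ⟨N, hN⟩ := eventually_atTop.1 (Metric.tendsto_nhds.1 hz δ hδ)
    exact ⟨fun k => vk (k + N), fun k => zk (k + N), fun k => M (k + N),
      hv.comp (tendsto_add_atTop_nat N), hz.comp (tendsto_add_atTop_nat N),
      fun k => ⟨(hN (k + N) (Nat.le_add_left _ _)).le, hzS _⟩, fun k => hM _,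
      fun k y hy => hin _ y hy.2⟩

lemma convexHull_limNormal_eq_Udelta {m : ℕ} {U : ℝ → Set (Vec m)} {ub : ℝ → Vec m} {δ t : ℝ}
    (hδ : 0 < δ) (hconv : Convex ℝ (Udelta U ub δ t)) (hub : ub t ∈ U t) :
    convexHull ℝ (limNormal dotv (U t) (ub t)) = limNormal dotv (Udelta U ub δ t) (ub t) := by
  have h : limNormal dotv (Udelta U ub δ t) (ub t) = limNormal dotv (U t) (ub t) :=
    limNormal_closedBall_inter hδ
  rw [← h]
  exact convexHull_limNormal_of_convex hconv ⟨Metric.mem_closedBall_self hδ.le, hub⟩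

end NormalCone

section Measurability

lemma aemeasurable_carath_comp {E : Type*} [TopologicalSpace E]
    [TopologicalSpace.PseudoMetrizableSpace E] [SecondCountableTopology E] {μ : Measure ℝ}
    {F : ℝ → E → ℝ} (hF : ∀ z, Measurable fun t => F t z) {z : ℝ → E}
    (hz : AEStronglyMeasurable z μ) (hc : ∀ᵐ t ∂μ, ContinuousAt (F t) (z t)) :
    AEMeasurable (fun t => F t (z t)) μ := by
  obtain ⟨z', hz', hzz'⟩ := hz
  have hs : ∀ s : SimpleFunc ℝ E, Measurable fun t => F t (s t) := fun s =>
    s.measurable_bind (fun z t => F t z) hF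
  refine aemeasurable_of_tendsto_metrizable_ae atTop
    (f := fun k t => F t (hz'.approx k t)) (fun k => (hs _).aemeasurable) ?_
  filter_upwards [hc, hzz'] with t ht hzt
  rw [hzt] at ht ⊢
  exact ht.tendsto.comp (hz'.tendsto_approx t)

lemma aemeasurable_fderiv_carath {E : Type*} [NormedAddCommGroup E] [NormedSpace ℝ E]
    [SecondCountableTopology E] {μ : Measure ℝ}
    {F : ℝ → E → ℝ} (hF : ∀ z, Measurable fun t => F t z) {z : ℝ → E}
    (hz : AEStronglyMeasurable z μ) {δ : ℝ} (hδ : 0 < δ)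
    (hd : ∀ᵐ t ∂μ, ∀ y ∈ Metric.ball (z t) δ, DifferentiableAt ℝ (F t) y) (e : E) :
    AEMeasurable (fun t => fderiv ℝ (F t) (z t) e) μ := by
  obtain ⟨k₀, hk₀⟩ := exists_nat_gt (‖e‖ / δ)
  set c : ℕ → ℝ := fun k => (k : ℝ) + k₀ + 1 with hcdef
  have hcpos : ∀ k, 0 < c k := fun k => by simp only [hcdef]; positivity
  refine aemeasurable_of_tendsto_metrizable_ae atTop
    (f := fun k t => c k • (F t (z t + (c k)⁻¹ • e) - F t (z t))) (fun k => ?_) ?_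
  · refine AEMeasurable.const_mul
      (f := fun t => F t (z t + (c k)⁻¹ • e) - F t (z t)) (AEMeasurable.sub ?_ ?_) (c k)
    · refine aemeasurable_carath_comp hF (hz.add aestronglyMeasurable_const) ?_
      filter_upwards [hd] with t ht
      refine (ht _ ?_).continuousAt
      rw [mem_ball_iff_norm]
      simp only [add_sub_cancel_left]
      rw [norm_smul, norm_inv, Real.norm_eq_abs, abs_of_pos (hcpos k),
        inv_mul_lt_iff₀ (hcpos k)]
      have h1 : ‖e‖ < k₀ * δ := (div_lt_iff₀ hδ).1 hk₀
      have h2 : (0 : ℝ) ≤ k := Nat.cast_nonneg k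
      simp only [hcdef]
      nlinarith
    · refine aemeasurable_carath_comp hF hz ?_
      filter_upwards [hd] with t ht
      exact (ht _ (Metric.mem_ball_self hδ)).continuousAt
  · filter_upwards [hd] with t ht
    refine (ht _ (Metric.mem_ball_self hδ)).hasFDerivAt.lim e ?_
    have h1 : Tendsto c atTop atTop := by
      simp only [hcdef, add_assoc]
      exact tendsto_atTop_add_const_right _ _ tendsto_natCast_atTop_atTop
    exact tendsto_norm_atTop_atTop.comp h1

lemma aestronglyMeasurable_gradFull_carath {n m : ℕ} {μ : Measure ℝ}
    {F : ℝ → Vec n × Vec m → ℝ} (hF : ∀ z, Measurable fun t => F t z) {z : ℝ → Vec n × Vec m}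
    (hz : AEStronglyMeasurable z μ) {δ : ℝ} (hδ : 0 < δ)
    (hd : ∀ᵐ t ∂μ, ∀ y ∈ Metric.ball (z t) δ, DifferentiableAt ℝ (F t) y) :
    AEStronglyMeasurable (fun t => gradFull (F t) (z t)) μ := by
  unfold gradFull
  refine AEMeasurable.aestronglyMeasurable (AEMeasurable.prodMk ?_ ?_) <;>
    exact aemeasurable_pi_lambda _ fun i => aemeasurable_fderiv_carath hF hz hδ hd _

lemma W11.continuousOn {t₀ t₁ : ℝ} {d : ℕ} (p : W11 t₀ t₁ d) :
    ContinuousOn p.x (Set.Icc t₀ t₁) := by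
  rcases le_or_gt t₀ t₁ with h | h
  · have h1 : IntegrableOn p.x' (Set.uIcc t₀ t₁) := by
      rw [Set.uIcc_of_le h]; exact p.int'
    have h2 := intervalIntegral.continuousOn_primitive_interval h1
    rw [Set.uIcc_of_le h] at h2
    exact (continuousOn_const.add h2).congr p.rep
  · rw [Set.Icc_eq_empty_of_lt h]
    exact continuousOn_empty _

end Measurability

section PointwiseSumRule

variable {n m mb mg : ℕ}

lemma gradFull_dotv {d : ℕ} (q : Vec d) {B : Vec n × Vec m → Vec d} {z : Vec n × Vec m}
    (hB : DifferentiableAt ℝ B z) :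
    gradFull (fun w => dotv q (B w)) z = ∑ i, q i • gradFull (fun w => B w i) z := by
  have hd : ∀ i, DifferentiableAt ℝ (fun w => B w i) z := differentiableAt_pi.1 hB
  have h : fderiv ℝ (fun w => dotv q (B w)) z = ∑ i, q i • fderiv ℝ (fun w => B w i) z := by
    unfold dotv
    rw [fderiv_fun_sum fun i _ => (hd i).const_mul _]
    exact Finset.sum_congr rfl fun i _ => fderiv_const_mul (hd i) _
  unfold gradFull
  rw [h]
  ext i <;> simp [Prod.fst_sum, Prod.snd_sum, Finset.sum_apply]

lemma gradFull_add {h k : Vec n × Vec m → ℝ} {z : Vec n × Vec m} (hh : DifferentiableAt ℝ h z)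
    (hk : DifferentiableAt ℝ k z) :
    gradFull (fun w => h w + k w) z = gradFull h z + gradFull k z := by
  unfold gradFull
  rw [fderiv_fun_add hh hk]
  rfl

lemma contDiffAt_dotv {d : ℕ} (q : Vec d) {B : Vec n × Vec m → Vec d} {z : Vec n × Vec m}
    (hB : ContDiffAt ℝ 1 B z) : ContDiffAt ℝ 1 (fun w => dotv q (B w)) z :=
  ContDiffAt.sum fun i _ => contDiffAt_const.mul (contDiffAt_pi.1 hB i)

lemma lipschitzOnWith_dotv {d : ℕ} (p : Vec d) {F : Vec n × Vec m → Vec d}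
    {s : Set (Vec n × Vec m)} {k : ℝ}
    (hF : ∀ z z', z ∈ s → z' ∈ s → ‖F z - F z'‖ ≤ k * ‖z - z'‖) :
    LipschitzOnWith (Real.toNNReal (d * (‖p‖ * |k|))) (fun z => dotv p (F z)) s := by
  refine LipschitzOnWith.of_dist_le_mul fun z hz z' hz' => ?_
  rw [Real.coe_toNNReal _ (by positivity), Real.dist_eq, dist_eq_norm]
  have h1 : dotv p (F z) - dotv p (F z') = dotv p (F z - F z') := by
    simp [dotv, mul_sub, Finset.sum_sub_distrib]
  rw [h1]
  have h2 : ‖F z - F z'‖ ≤ |k| * ‖z - z'‖ :=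
    (hF z z' hz hz').trans (by gcongr; exact le_abs_self k)
  calc |dotv p (F z - F z')| ≤ d * (‖p‖ * ‖F z - F z'‖) := abs_dotv_le _ _
    _ ≤ d * (‖p‖ * (|k| * ‖z - z'‖)) := by gcongr
    _ = _ := by ring

/-- The gradient of the constraint part `q·b + r·g` of the augmented Pontryagin function. -/
noncomputable abbrev constraintGrad (b : ℝ → Vec n × Vec m → Vec mb) (g : ℝ → Vec n × Vec m → Vec mg)
    (t : ℝ) (q : Vec mb) (r : Vec mg) (z : Vec n × Vec m) : Vec n × Vec m :=
  (∑ i, q i • gradFull (fun w => b t w i) z) + ∑ j, r j • gradFull (fun w => g t w j) z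

lemma mem_clarke_Ham_iff {f : ℝ → Vec n × Vec m → Vec n} {b : ℝ → Vec n × Vec m → Vec mb}
    {g : ℝ → Vec n × Vec m → Vec mg} {t : ℝ} {z : Vec n × Vec m} {s : Set (Vec n × Vec m)}
    {k : ℝ} (hs : s ∈ 𝓝 z)
    (hf : ∀ y y', y ∈ s → y' ∈ s → ‖f t y - f t y'‖ ≤ k * ‖y - y'‖)
    (hbg : ContDiffAt ℝ 1 (fun w => (b t w, g t w)) z) (p : Vec n) (q : Vec mb) (r : Vec mg)
    (ξ : Vec n × Vec m) :
    ξ ∈ clarke (pairProd dotv dotv) (Ham f b g t p q r) z ↔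
      ξ - constraintGrad b g t q r z ∈ clarke (pairProd dotv dotv) (fun w => dotv p (f t w)) z := by
  have hb : ContDiffAt ℝ 1 (b t) z := hbg.fst
  have hg : ContDiffAt ℝ 1 (g t) z := hbg.snd
  have hH : Ham f b g t p q r =
      fun w => dotv p (f t w) + (dotv q (b t w) + dotv r (g t w)) := by
    ext w; simp only [Ham]; ring
  have hqb := contDiffAt_dotv q hb
  have hrg := contDiffAt_dotv r hg
  rw [hH, mem_clarke_add_smooth_iff hs (lipschitzOnWith_dotv p hf) (hqb.add hrg),
    gradFull_add (hqb.differentiableAt one_ne_zero) (hrg.differentiableAt one_ne_zero),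
    gradFull_dotv q (hb.differentiableAt one_ne_zero),
    gradFull_dotv r (hg.differentiableAt one_ne_zero)]

/-- Complementary slackness in scalar form and in componentwise form coincide at feasible points. -/
lemma complementarity_iff {g : ℝ → Vec n × Vec m → Vec mg} {t : ℝ} {z : Vec n × Vec m}
    {r : Vec mg} (hg : ∀ j, g t z j ≤ 0) :
    (dotv r (g t z) = 0 ∧ ∀ j, r j ≤ 0) ↔ ∀ j, r j * gneg g t z j = 0 ∧ r j ≤ 0 := by
  have hn : ∀ j, gneg g t z j = -(g t z j) := fun j => max_eq_left (by linarith [hg j])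
  simp only [hn, mul_neg, neg_eq_zero]
  constructor
  · rintro ⟨h0, hr⟩ j
    exact ⟨(Finset.sum_eq_zero_iff_of_nonneg fun i _ =>
      mul_nonneg_of_nonpos_of_nonpos (hr i) (hg i)).1 h0 j (Finset.mem_univ j), hr j⟩
  · exact fun h => ⟨Finset.sum_eq_zero fun j _ => (h j).1, fun j => (h j).2⟩

end PointwiseSumRule

/-- Lemma 3.1: Let (x̄,ū) be a feasible process for (P). If, for some
δ > 0, Hypotheses (H1)–(H6) are satisfied, then (x̄,ū) satisfies the conditions of the
classical weak maximum principle if and only if ℳ(x̄,ū) ∩ (−ℳ_δ(x̄,ū,0)) ≠ ∅. -/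
theorem wmp_iff_Mset_inter_neg_Mdelta_nonempty
    (t₀ t₁ : ℝ) (n m mb mg : ℕ)
    (ell : Vec n × Vec n → ℝ) (f : ℝ → Vec n × Vec m → Vec n)
    (b : ℝ → Vec n × Vec m → Vec mb) (g : ℝ → Vec n × Vec m → Vec mg)
    (U : ℝ → Set (Vec m)) (C : Set (Vec n × Vec n))
    (xb : W11 t₀ t₁ n) (ub : ℝ → Vec m) (δ : ℝ) (hδ : 0 < δ)
    (hfeas : Feasible t₀ t₁ f b g U C xb ub)
    (h1 : Hyp1 t₀ t₁ f xb ub δ)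
    (h2 : Hyp2 t₀ t₁ U ub δ)
    (h3 : Hyp3 t₀ t₁ ell C xb)
    (h4 : Hyp4 t₀ t₁ b g)
    (h5 : Hyp5 t₀ t₁ b g xb ub δ)
    (h6 : Hyp6 t₀ t₁ f b g xb ub) :
    SatisfiesWMP t₀ t₁ ell f b g U C xb ub ↔
      ∃ kψ : ℝ → ℝ, IntegrableOn kψ (Set.Icc t₀ t₁) volume ∧
        (Mset t₀ t₁ ell f xb ub ∩
          (-(Mdelta t₀ t₁ b g U C xb ub δ kψ xb ub (fun _ => 0)))).Nonempty := by


  obtain ⟨hub, -, -, hg0, hubU, -⟩ := hfeas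
  obtain ⟨-, kf, hkf, hf⟩ := h1
  obtain ⟨hbg, -⟩ := h5
  set μ := volume.restrict (Set.Icc t₀ t₁)
  have hball : ∀ t, Metric.closedBall (xb.x t, ub t) δ ∈ 𝓝 (xb.x t, ub t) :=
    fun t => Metric.closedBall_mem_nhds _ hδ
  have hbgC : ∀ᵐ t ∂μ, ∀ y ∈ Metric.ball (xb.x t, ub t) δ,
      ContDiffAt ℝ 1 (fun z => (b t z, g t z)) y := by
    filter_upwards [hbg] with t ht y hy
    exact ht.contDiffAt (Filter.mem_of_superset (Metric.isOpen_ball.mem_nhds hy)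
      Metric.ball_subset_closedBall)
  constructor
  · rintro ⟨lam, p, q, r, ζ, hlam, hq, hr, hζ, hne, hadj, hN, hcomp, ⟨a, ha, c, hc, hac⟩⟩
    have hz : AEStronglyMeasurable (fun t => (xb.x t, ub t)) μ :=
      (xb.continuousOn.aestronglyMeasurable measurableSet_Icc).prodMk hub.aestronglyMeasurable
    set D : ℝ → Vec n × Vec m := fun t => constraintGrad b g t (q t) (r t) (xb.x t, ub t)
    have hDm : AEStronglyMeasurable D μ := by
      have hcoord : ∀ {d : ℕ} {w : ℝ → Vec d}, L1On t₀ t₁ w → ∀ i,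
          AEStronglyMeasurable (fun t => w t i) μ := fun hw i =>
        (continuous_apply i).comp_aestronglyMeasurable hw.aestronglyMeasurable
      refine AEStronglyMeasurable.add
        (Finset.aestronglyMeasurable_fun_sum _ fun i _ => (hcoord hq i).smul ?_)
        (Finset.aestronglyMeasurable_fun_sum _ fun j _ => (hcoord hr j).smul ?_)
      · refine aestronglyMeasurable_gradFull_carath
          (fun z => (measurable_pi_apply i).comp (h4 z).1) hz hδ ?_
        filter_upwards [hbgC] with t ht y hy
        exact differentiableAt_pi.1 ((ht y hy).fst.differentiableAt one_ne_zero) i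
      · refine aestronglyMeasurable_gradFull_carath
          (fun z => (measurable_pi_apply j).comp (h4 z).2) hz hδ ?_
        filter_upwards [hbgC] with t ht y hy
        exact differentiableAt_pi.1 ((ht y hy).snd.differentiableAt one_ne_zero) j
    have hadj' : ∀ᵐ t ∂μ, (-(p.x' t), ζ t) - D t ∈
        clarke (pairProd dotv dotv) (fun z => dotv (p.x t) (f t z)) (xb.x t, ub t) := by
      filter_upwards [hadj, hbgC, hf] with t h1 h2 h3
      exact (mem_clarke_Ham_iff (hball t) h3 (h2 _ (Metric.mem_ball_self hδ)) _ _ _ _).1 h1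
    obtain ⟨P, hP⟩ := isCompact_Icc.exists_bound_of_continuousOn p.continuousOn
    have hW : Integrable (fun t => ((-(p.x' t), ζ t) : Vec n × Vec m) - D t) μ := by
      refine Integrable.mono' (g := fun t => n * (P * |kf t|)) ?_ ?_ ?_
      · exact ((Integrable.abs hkf).const_mul P).const_mul n
      · exact (p.int'.aestronglyMeasurable.neg.prodMk hζ.aestronglyMeasurable).sub hDm
      · filter_upwards [hadj', hf, ae_restrict_mem measurableSet_Icc] with t h1 h2 h3
        refine (norm_le_of_mem_clarke (hball t) (lipschitzOnWith_dotv _ h2) h1).trans ?_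
        rw [Real.coe_toNNReal _ (by positivity)]
        have := hP t h3
        gcongr
    have hΨ : L1On t₀ t₁ (fun t => ζ t - (D t).2) := hW.snd
    have hΦ : L1On t₀ t₁ (fun t => -(D t).1) := by
      refine (hW.fst.add p.int').congr (Filter.Eventually.of_forall fun t => ?_)
      simp only [Pi.add_apply, Prod.fst_sub]
      abel
    refine ⟨fun t => ‖ζ t - (D t).2‖, hΨ.norm,
      (fun t => -(D t).1, fun t => ζ t - (D t).2, -c.1, -c.2),
      ⟨hΦ, hΨ, lam, p, hlam, hne, ?_, ?_⟩, hΦ.neg, hΨ.neg, q, r, ζ, hq, hr, hζ,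
      ?_, ?_, ?_, ?_, ?_, ?_⟩
    · filter_upwards [hadj'] with t ht
      convert ht using 1
      ext1 <;> simp [sub_eq_add_neg, add_comm]
    · have h1 : (-c.1 + p.x t₀, -c.2 - p.x t₁) = a := by
        have h2 : a = (p.x t₀, -p.x t₁) - c := eq_sub_of_add_eq hac
        rw [h2]
        ext1 <;> simp [sub_eq_add_neg, add_comm]
      simpa only [h1] using ha
    · exact Filter.Eventually.of_forall fun t => Metric.mem_closedBall_self hδ.le
    · refine Filter.Eventually.of_forall fun t => ?_
      have h1 : ((-fun t => -(D t).1) t, (-fun t => ζ t - (D t).2) t) = D t + (0, -ζ t) := by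
        ext1 <;> simp [sub_eq_add_neg, add_comm]
      exact h1
    · filter_upwards [hN, h2.2, hubU] with t h1 h3 h4
      rwa [convexHull_limNormal_eq_Udelta hδ h3.2 h4] at h1
    · filter_upwards [hcomp, hg0] with t h1 h3
      exact (complementarity_iff h3).1 h1
    · refine Filter.Eventually.of_forall fun t => ?_
      exact (norm_neg (ζ t - (D t).2)).le
    · simpa using hc
  · rintro ⟨kψ, -, Φ, ⟨-, -, lam, p, hlam, hne, hadj, htr⟩, -, -, q, r, ζ, hq, hr, hζ, -, hΦ, hN,
      hcomp, -, hC⟩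
    refine ⟨lam, p, q, r, ζ, hlam, hq, hr, hζ, hne, ?_, ?_, ?_, _, htr, _, hC, ?_⟩
    · filter_upwards [hadj, hbgC, hf, hΦ] with t h1 h2 h3 h4
      refine (mem_clarke_Ham_iff (hball t) h3 (h2 _ (Metric.mem_ball_self hδ)) _ _ _ _).2 ?_
      have h5 : constraintGrad b g t (q t) (r t) (xb.x t, ub t) =
          ((-Φ.1 t, -Φ.2.1 t) : Vec n × Vec m) + (0, ζ t) := by
        have h6 : ((-Φ.1 t, -Φ.2.1 t) : Vec n × Vec m) = _ := h4
        rw [h6, add_assoc]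
        simp
      rw [h5]
      convert h1 using 1
      ext1 <;> simp [sub_eq_add_neg, add_comm]
    · filter_upwards [hN, h2.2, hubU] with t h1 h3 h4
      rwa [convexHull_limNormal_eq_Udelta hδ h3.2 h4]
    · filter_upwards [hcomp, hg0] with t h1 h3
      exact (complementarity_iff h3).2 h1
    · ext1 <;> simp [sub_eq_add_neg, add_right_comm]
end

section
/- For each k ∈ ℕ, k ≥ 1, define q¹ᵏ: [0,1] → ℝ by q¹ᵏ(t) = 0 for t ∈ [0, k/(k+1)) and q¹ᵏ(t) = −(k+1)/2 for t ∈ (k/(k+1), 1]. Then there is no Lebesgue-integrable function c: [0,1] → ℝ such that, for every k, |q¹ᵏ(t)| ≤ c(t) for almost every t ∈ [0,1]. In other words, the sequence {q¹ᵏ} cannot be bounded almost everywhere in [0,1] by an integrable function independent of k. -/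
open MeasureTheory Filter Topology

/-- The multipliers q₁ᵏ: 0 on [0, k/(k+1)) and −(k+1)/2 on [k/(k+1), 1]. -/
noncomputable def q1 (k : ℕ) (t : ℝ) : ℝ :=
  if t < (k : ℝ) / ((k : ℝ) + 1) then 0 else -(((k : ℝ) + 1) / 2)

/-- The multiplier is the constant `-(k+1)/2` on the half-line `[k/(k+1), ∞)` and zero elsewhere. -/
lemma q1_eq_indicator (k : ℕ) :
    q1 k = (Set.Ici ((k : ℝ) / ((k : ℝ) + 1))).indicator (fun _ => -(((k : ℝ) + 1) / 2)) := by
  ext t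
  by_cases h : t < (k : ℝ) / ((k : ℝ) + 1) <;> simp [q1, Set.indicator, h, ← not_lt]

lemma measurable_q1 (k : ℕ) : Measurable (q1 k) := by
  rw [q1_eq_indicator]
  exact measurable_const.indicator measurableSet_Ici

lemma setIntegral_q1 (k : ℕ) : ∫ t in Set.Icc (0 : ℝ) 1, q1 k t = -(1 / 2) := by
  have hk : (0 : ℝ) < (k : ℝ) + 1 := by positivity
  have h0 : (0 : ℝ) ≤ (k : ℝ) / ((k : ℝ) + 1) := by positivity
  have h1 : (k : ℝ) / ((k : ℝ) + 1) ≤ 1 := (div_le_one hk).2 (by linarith)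
  have hinter : Set.Icc (0 : ℝ) 1 ∩ Set.Ici ((k : ℝ) / ((k : ℝ) + 1)) =
      Set.Icc ((k : ℝ) / ((k : ℝ) + 1)) 1 := by
    ext t
    simp only [Set.mem_inter_iff, Set.mem_Icc, Set.mem_Ici]
    exact ⟨fun h => ⟨h.2, h.1.2⟩, fun h => ⟨⟨h0.trans h.1, h.2⟩, h.1⟩⟩
  rw [q1_eq_indicator, setIntegral_indicator measurableSet_Ici, hinter, setIntegral_const,
    Real.volume_real_Icc_of_le h1, smul_eq_mul]
  field_simp
  ring

lemma tendsto_q1_zero {t : ℝ} (ht : t < 1) : Tendsto (fun k => q1 k t) atTop (𝓝 0) := by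
  refine tendsto_const_nhds.congr' ?_
  filter_upwards [(tendsto_natCast_div_add_atTop (1 : ℝ)).eventually_const_lt ht] with k hk
  simp [q1, hk]

/-- There is no Lebesgue-integrable function c on [0,1] such that, for
every k ≥ 1, |q₁ᵏ(t)| ≤ c(t) for almost every t ∈ [0,1]; i.e. the sequence {q₁ᵏ} cannot
be bounded a.e. by an integrable function independent of k. -/
theorem no_integrable_uniform_bound_for_q1 :
    ¬ ∃ c : ℝ → ℝ, IntegrableOn c (Set.Icc (0:ℝ) 1) volume ∧
      ∀ k : ℕ, 1 ≤ k →
        ∀ᵐ t ∂(volume.restrict (Set.Icc (0:ℝ) 1)), |q1 k t| ≤ c t := by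
  rintro ⟨c, hc, hbound⟩
  have hlim : ∀ᵐ t ∂(volume.restrict (Set.Icc (0 : ℝ) 1)),
      Tendsto (fun k => q1 (k + 1) t) atTop (𝓝 0) := by
    have hne : ∀ᵐ t ∂(volume.restrict (Set.Icc (0 : ℝ) 1)), t ≠ 1 :=
      ae_restrict_of_ae (Measure.ae_ne volume 1)
    filter_upwards [hne, ae_restrict_mem measurableSet_Icc] with t hne ht
    exact (tendsto_q1_zero (lt_of_le_of_ne ht.2 hne)).comp (tendsto_add_atTop_nat 1)
  have htendsto := tendsto_integral_of_dominated_convergence c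
    (fun k => (measurable_q1 (k + 1)).aestronglyMeasurable) hc
    (fun k => hbound (k + 1) (Nat.le_add_left 1 k)) hlim
  simp only [setIntegral_q1, integral_zero] at htendsto
  have := tendsto_nhds_unique htendsto tendsto_const_nhds
  norm_num at this
end

section
/- Let [t₀,t₁] ⊂ ℝ be a compact interval with Lebesgue measure. Let {rᵏ} be a sequence of measurable functions on [t₀,t₁] with |rᵏ(t)| ≤ 1 and rᵏ(t) ≤ 0 a.e. for all k, converging weak-star in L^∞([t₀,t₁]) to r. Let h ∈ L¹([t₀,t₁]) and let {hᵏ} be measurable functions with hᵏ(t) → h(t) a.e. and |hᵏ(t) − h(t)| ≤ d(t) a.e. for all k, for some integrable d. Suppose furthermore that rᵏ(t)hᵏ(t) → 0 a.e. and that |rᵏ(t)hᵏ(t)| ≤ ĉ(t) a.e. for all k, for some integrable ĉ. Then r(t) ≤ 0 a.e. and r(t)h(t) = 0 a.e. in [t₀,t₁]. -/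
open MeasureTheory Filter Topology

/-- Dividing an integrable function by `1 + |r|` keeps it integrable. -/
lemma integrable_div_one_add_abs {α : Type*} [MeasurableSpace α] {μ : Measure α}
    {r g : α → ℝ} (hr : Measurable r) (hg : Integrable g μ) :
    Integrable (fun t => g t / (1 + |r t|)) μ := by
  have hm : Measurable fun t => 1 + |r t| := measurable_const.add hr.abs
  refine hg.mono (hg.aestronglyMeasurable.aemeasurable.div
    hm.aemeasurable).aestronglyMeasurable (ae_of_all _ fun t => ?_)
  have h1 : 1 ≤ 1 + |r t| := by linarith [abs_nonneg (r t)]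
  rw [Real.norm_eq_abs, Real.norm_eq_abs, abs_div, abs_of_pos (by linarith : 0 < 1 + |r t|)]
  exact div_le_self (abs_nonneg _) h1

/-- The damping factor `1 / (1 + |r|)` makes a function integrable against `r`, whatever the
size of `r`. -/
lemma integrable_mul_div_one_add_abs {α : Type*} [MeasurableSpace α] {μ : Measure α}
    {r g : α → ℝ} (hr : Measurable r) (hg : Integrable g μ) :
    Integrable (fun t => r t * (g t / (1 + |r t|))) μ := by
  refine hg.mono (hr.aestronglyMeasurable.mul
    (integrable_div_one_add_abs hr hg).aestronglyMeasurable) (ae_of_all _ fun t => ?_)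
  have h0 : 0 < 1 + |r t| := by linarith [abs_nonneg (r t)]
  rw [Real.norm_eq_abs, Real.norm_eq_abs, abs_mul, abs_div, abs_of_pos h0, ← mul_div_assoc,
    div_le_iff₀ h0]
  nlinarith [abs_nonneg (g t)]

/-- If `u k * v k → 0`, `v k → w` and `u` is bounded by `1`, then `u k * w → 0`. -/
lemma tendsto_mul_limit_zero {u v : ℕ → ℝ} {w : ℝ} (hu : ∀ k, |u k| ≤ 1)
    (hv : Tendsto v atTop (𝓝 w)) (huv : Tendsto (fun k => u k * v k) atTop (𝓝 0)) :
    Tendsto (fun k => u k * w) atTop (𝓝 0) := by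
  have hvw : Tendsto (fun k => |v k - w|) atTop (𝓝 0) := by
    simpa using (hv.sub_const w).abs
  have hdiff : Tendsto (fun k => u k * (v k - w)) atTop (𝓝 0) := by
    refine squeeze_zero_norm (fun k => ?_) hvw
    rw [Real.norm_eq_abs, abs_mul]
    exact mul_le_of_le_one_left (abs_nonneg _) (hu k)
  simpa [mul_sub] using huv.sub hdiff

/-- limit passage in the complementarity conditions: if rᵏ are
nonpositive, bounded by 1, converging weak-star in L^∞ to r; hᵏ → h a.e. with an
integrable dominating bound; rᵏhᵏ → 0 a.e. with an integrable dominating bound; then in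
the limit r ≤ 0 a.e. and r·h = 0 a.e. -/
theorem limit_complementarity
    (t₀ t₁ : ℝ) (ht : t₀ ≤ t₁)
    (r : ℝ → ℝ) (rk : ℕ → ℝ → ℝ) (h : ℝ → ℝ) (hk : ℕ → ℝ → ℝ) (d chat : ℝ → ℝ)
    (hrkmeas : ∀ k, Measurable (rk k))
    (hrmeas : Measurable r)
    (hrk_bd : ∀ k, ∀ᵐ t ∂(volume.restrict (Set.Icc t₀ t₁)), |rk k t| ≤ 1)
    (hrk_neg : ∀ k, ∀ᵐ t ∂(volume.restrict (Set.Icc t₀ t₁)), rk k t ≤ 0)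
    -- weak-star convergence rᵏ ⇀* r in L^∞([t₀,t₁]): testing against every L¹ function
    (hws : ∀ φ : ℝ → ℝ, IntegrableOn φ (Set.Icc t₀ t₁) volume →
      Tendsto (fun k => ∫ t in Set.Icc t₀ t₁, rk k t * φ t) atTop
        (𝓝 (∫ t in Set.Icc t₀ t₁, r t * φ t)))
    (hh : IntegrableOn h (Set.Icc t₀ t₁) volume)
    (hhkmeas : ∀ k, Measurable (hk k))
    (hhk_conv : ∀ᵐ t ∂(volume.restrict (Set.Icc t₀ t₁)),
      Tendsto (fun k => hk k t) atTop (𝓝 (h t)))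
    (hd : IntegrableOn d (Set.Icc t₀ t₁) volume)
    (hhk_dom : ∀ k, ∀ᵐ t ∂(volume.restrict (Set.Icc t₀ t₁)), |hk k t - h t| ≤ d t)
    (hprod_conv : ∀ᵐ t ∂(volume.restrict (Set.Icc t₀ t₁)),
      Tendsto (fun k => rk k t * hk k t) atTop (𝓝 0))
    (hchat : IntegrableOn chat (Set.Icc t₀ t₁) volume)
    (hprod_dom : ∀ k, ∀ᵐ t ∂(volume.restrict (Set.Icc t₀ t₁)), |rk k t * hk k t| ≤ chat t) :
    (∀ᵐ t ∂(volume.restrict (Set.Icc t₀ t₁)), r t ≤ 0) ∧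
    (∀ᵐ t ∂(volume.restrict (Set.Icc t₀ t₁)), r t * h t = 0) := by
  set μ := volume.restrict (Set.Icc t₀ t₁) with hμ
  have hpos : ∀ t, 0 < 1 + |r t| := fun t => by linarith [abs_nonneg (r t)]
  have hneg : ∀ᵐ t ∂μ, r t ≤ 0 := by
    have hg : Integrable ({t | 0 < r t}.indicator fun _ => (1 : ℝ)) μ :=
      (integrable_const 1).indicator (measurableSet_lt measurable_const hrmeas)
    have hg0 : ∀ t, 0 ≤ ({t | 0 < r t}.indicator fun _ => (1 : ℝ)) t :=
      Set.indicator_nonneg fun _ _ => zero_le_one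
    have hle := le_of_tendsto (hws _ (integrable_div_one_add_abs hrmeas hg))
      (Eventually.of_forall fun k => integral_nonpos_of_ae <| by
        filter_upwards [hrk_neg k] with t h1
        exact mul_nonpos_of_nonpos_of_nonneg h1 (div_nonneg (hg0 t) (hpos t).le))
    have hnn : ∀ t, 0 ≤ r t * (({t | 0 < r t}.indicator fun _ => (1 : ℝ)) t / (1 + |r t|)) := by
      intro t
      by_cases hrt : 0 < r t
      · exact mul_nonneg hrt.le (div_nonneg (hg0 t) (hpos t).le)
      · simp [Set.indicator, hrt]
    have hzero := (integral_eq_zero_iff_of_nonneg hnn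
      (integrable_mul_div_one_add_abs hrmeas hg)).1 (le_antisymm hle (integral_nonneg hnn))
    filter_upwards [hzero] with t h1
    by_contra! hrt
    have h2 : r t * (1 / (1 + |r t|)) = 0 := by simpa [Set.indicator, hrt] using h1
    exact (mul_pos hrt (one_div_pos.2 (hpos t))).ne' h2
  refine ⟨hneg, ?_⟩
  have hφ := integrable_div_one_add_abs hrmeas hh.abs
  have hlim : Tendsto (fun k => ∫ t, rk k t * (|h t| / (1 + |r t|)) ∂μ) atTop (𝓝 0) := by
    have hdct := tendsto_integral_of_dominated_convergence (μ := μ)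
      (F := fun k t => rk k t * (|h t| / (1 + |r t|))) (f := fun _ => 0)
      (fun t => |h t| / (1 + |r t|))
      (fun k => (hrkmeas k).aestronglyMeasurable.mul hφ.aestronglyMeasurable) hφ
      (fun k => by
        filter_upwards [hrk_bd k] with t h1
        have h2 : 0 ≤ |h t| / (1 + |r t|) := div_nonneg (abs_nonneg _) (hpos t).le
        rw [Real.norm_eq_abs, abs_mul, abs_of_nonneg h2]
        exact mul_le_of_le_one_left h2 h1)
      (by
        filter_upwards [ae_all_iff.2 hrk_bd, hhk_conv, hprod_conv] with t h1 h2 h3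
        have h4 := (tendsto_mul_limit_zero h1 h2 h3).mul_const (SignType.sign (h t) / (1 + |r t|) : ℝ)
        rw [zero_mul] at h4
        refine h4.congr fun k => ?_
        rw [← self_mul_sign (h t)]
        ring)
    simpa using hdct
  have hint := tendsto_nhds_unique (hws _ hφ) hlim
  have hnn : 0 ≤ᵐ[μ] fun t => -(r t * (|h t| / (1 + |r t|))) := by
    filter_upwards [hneg] with t h1
    exact neg_nonneg.2
      (mul_nonpos_of_nonpos_of_nonneg h1 (div_nonneg (abs_nonneg _) (hpos t).le))
  have hzero := (integral_eq_zero_iff_of_nonneg_ae hnn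
    (integrable_mul_div_one_add_abs hrmeas hh.abs).neg).1 (by rw [integral_neg, hint, neg_zero])
  filter_upwards [hzero] with t h1
  simpa [(hpos t).ne'] using h1
end
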